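/- arXiv:math/0603585 — 3 statements merged into one kernel-verified Lean document; each statement's English description precedes it below -/
import Mathlib

section
/- Suppose X is a compact metrizable space with metric ρ and T : X → X is a surjective continuous map. Then LY(X, T) ∩ IE_2(X, T) is dense in IE_2(X, T) \ Δ_2(X). -/
open Filter Set

/-- `J ⊆ ℕ` is an independence set for the tuple `A = (A 0, …, A (k-1))` of subsets of `X`
with respect to the map `T`. -/
def IsIndepSet {X : Type*} (T : X → X) {k : ℕ} (A : Fin k → Set X) (J : Set ℕ) : Prop :=
  ∀ I : Finset ℕ, I.Nonempty → ↑I ⊆ J → ∀ σ : ℕ → Fin k,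
    (⋂ s ∈ I, T^[s] ⁻¹' A (σ s)).Nonempty

/-- `J ⊆ ℕ` has positive density: the limit of `|J ∩ {0,…,n}| / (n+1)` exists and is nonzero. -/
def HasPosDensity (J : Set ℕ) : Prop :=
  ∃ d : ℝ, d ≠ 0 ∧
    Tendsto (fun n : ℕ => (Nat.card (J ∩ Set.Iic n : Set ℕ) : ℝ) / (n + 1)) atTop (nhds d)

/-- The tuple `A` has an independence set of positive density. -/
def HasIndepSetPosDensity {X : Type*} (T : X → X) {k : ℕ} (A : Fin k → Set X) : Prop :=
  ∃ J : Set ℕ, IsIndepSet T A J ∧ HasPosDensity J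

/-- `x` is an IE-tuple: every product neighbourhood of `x` has an independence set of
positive density. -/
def IsIETuple {X : Type*} [TopologicalSpace X] (T : X → X) {k : ℕ} (x : Fin k → X) : Prop :=
  ∀ U : Fin k → Set X, (∀ i, IsOpen (U i)) → (∀ i, x i ∈ U i) →
    HasIndepSetPosDensity T U

/-- A hereditary, translation-closed family of finite sets whose members are occasionally larger
than `r * n + C` inside `{0, …, n-1}` has a member all of whose short prefixes have density
at least `r`. -/
theorem exists_prefix_dense {F : Finset ℕ → Prop} (hmono : ∀ ⦃I J⦄, I ⊆ J → F J → F I)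
    (hshift : ∀ k I, F (I.image (· + k)) → F I) {r : ℝ} (M : ℕ)
    (h : ∀ C : ℝ, ∃ n I, F I ∧ I ⊆ Finset.range n ∧ r * n + C < I.card) :
    ∃ S, F S ∧ ∀ m ≤ M, r * m ≤ (S.filter (· < m)).card := by
  by_contra! hcon
  have key : ∀ n I, F I → I ⊆ Finset.range n → (I.card : ℝ) ≤ r * n + M := by
    intro n
    induction n using Nat.strong_induction_on with
    | _ n ih =>
      intro I hI hIn
      obtain ⟨m, hmM, hm⟩ := hcon I hI
      have hm0 : 0 < m := by
        rcases Nat.eq_zero_or_pos m with rfl | h0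
        · simp at hm
        · exact h0
      have hm0' : (0 : ℝ) < m := by exact_mod_cast hm0
      have hr : 0 ≤ r := by
        by_contra! hr
        have : (0 : ℝ) ≤ (I.filter (· < m)).card := by positivity
        nlinarith
      rcases le_or_gt n m with hnm | hnm
      · have h1 : I.card ≤ M := by
          have := Finset.card_le_card hIn
          rw [Finset.card_range] at this
          omega
        have h1' : (I.card : ℝ) ≤ M := by exact_mod_cast h1
        have : 0 ≤ r * n := by positivity
        linarith
      · set K := (I.filter (fun i => ¬ i < m)).image (· - m) with hK
        have hKI : K.image (· + m) ⊆ I := by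
          intro x hx
          simp only [hK, Finset.mem_image, Finset.mem_filter] at hx
          obtain ⟨_, ⟨y, ⟨hy, hym⟩, rfl⟩, rfl⟩ := hx
          rwa [Nat.sub_add_cancel (not_lt.1 hym)]
        have hKc : K.card = (I.filter (fun i => ¬ i < m)).card := by
          refine Finset.card_image_of_injOn ?_
          intro x hx y hy hxy
          simp only [Finset.coe_filter, Set.mem_ofPred_eq] at hx hy hxy
          omega
        have hKr : K ⊆ Finset.range (n - m) := by
          intro x hx
          simp only [hK, Finset.mem_image, Finset.mem_filter] at hx
          obtain ⟨y, ⟨hy, hym⟩, rfl⟩ := hx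
          have := Finset.mem_range.1 (hIn hy)
          rw [Finset.mem_range]
          omega
        have h2 := ih (n - m) (by omega) K (hshift m K (hmono hKI hI)) hKr
        rw [Nat.cast_sub hnm.le, hKc] at h2
        have h3 := Finset.card_filter_add_card_filter_not (s := I) (fun i => i < m)
        have h3' : ((I.filter (· < m)).card : ℝ) + (I.filter (fun i => ¬ i < m)).card = I.card := by
          exact_mod_cast h3
        nlinarith
  obtain ⟨n, I, hI, hIn, hlt⟩ := h M
  exact absurd (key n I hI hIn) (not_le.2 hlt)

theorem natCard_inter_Iic (J : Set ℕ) [DecidablePred (· ∈ J)] (n : ℕ) :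
    Nat.card (J ∩ Set.Iic n : Set ℕ) = ((Finset.range (n + 1)).filter (· ∈ J)).card := by
  rw [Nat.card_coe_set_eq, ← Set.ncard_coe_finset]
  congr 1
  ext i
  simp [and_comm]

/-- A hereditary, translation-closed family of finite sets with members of positive upper density
admits an infinite set of positive density all of whose finite subsets belong to the family. -/
theorem exists_hasPosDensity {F : Finset ℕ → Prop} (hmono : ∀ ⦃I J⦄, I ⊆ J → F J → F I)
    (hshift : ∀ k I, F (I.image (· + k)) → F I) {c : ℝ} (hc : 0 < c)
    (h : ∃ᶠ n : ℕ in atTop, ∃ I, F I ∧ I ⊆ Finset.range n ∧ c * n ≤ I.card) :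
    ∃ J : Set ℕ, (∀ I : Finset ℕ, ↑I ⊆ J → F I) ∧ HasPosDensity J := by
  classical
  have hF0 : F ∅ := by
    obtain ⟨n, I, hI, -⟩ := h.exists
    exact hmono (Finset.empty_subset I) hI
  have hmax : ∀ n, ∃ I, (F I ∧ I ⊆ Finset.range n) ∧
      ∀ K, F K → K ⊆ Finset.range n → K.card ≤ I.card := by
    intro n
    obtain ⟨I, hI, hIm⟩ := Finset.exists_max_image ((Finset.range n).powerset.filter F) Finset.card
      ⟨∅, by simp [hF0]⟩
    simp only [Finset.mem_filter, Finset.mem_powerset] at hI hIm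
    exact ⟨I, hI.symm, fun K hK hKn => hIm K ⟨hKn, hK⟩⟩
  choose B hB hBmax using hmax
  set u : ℕ → ℝ := fun n => (B n).card with hu
  have hsub : Subadditive u := by
    intro m n
    set K := ((B (m + n)).filter (fun i => ¬ i < m)).image (· - m) with hK
    have hKI : K.image (· + m) ⊆ B (m + n) := by
      intro x hx
      simp only [hK, Finset.mem_image, Finset.mem_filter] at hx
      obtain ⟨_, ⟨y, ⟨hy, hym⟩, rfl⟩, rfl⟩ := hx
      rwa [Nat.sub_add_cancel (not_lt.1 hym)]
    have hKc : K.card = ((B (m + n)).filter (fun i => ¬ i < m)).card := by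
      refine Finset.card_image_of_injOn ?_
      intro x hx y hy hxy
      simp only [Finset.coe_filter, Set.mem_ofPred_eq] at hx hy hxy
      omega
    have hKr : K ⊆ Finset.range n := by
      intro x hx
      simp only [hK, Finset.mem_image, Finset.mem_filter] at hx
      obtain ⟨y, ⟨hy, hym⟩, rfl⟩ := hx
      have := Finset.mem_range.1 ((hB _).2 hy)
      rw [Finset.mem_range]
      omega
    have h1 := hBmax n K (hshift m K (hmono hKI (hB _).1)) hKr
    have h2 := hBmax m ((B (m + n)).filter (· < m)) (hmono (Finset.filter_subset _ _) (hB _).1)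
      (fun x hx => Finset.mem_range.2 (Finset.mem_filter.1 hx).2)
    have h3 := Finset.card_filter_add_card_filter_not (s := B (m + n)) (fun i => i < m)
    simp only [hu]
    exact_mod_cast (by omega : (B (m + n)).card ≤ (B m).card + (B n).card)
  have hbdd : BddBelow (range fun n => u n / n) := by
    refine ⟨0, ?_⟩
    rintro _ ⟨n, rfl⟩
    simp only [hu]
    positivity
  have hlim := hsub.tendsto_lim hbdd
  set d := hsub.lim with hd
  have hdu : ∀ n : ℕ, d * n ≤ u n := by
    intro n
    rcases Nat.eq_zero_or_pos n with rfl | hn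
    · simp [hu]
    · have := hsub.lim_le_div hbdd hn.ne'
      rwa [le_div_iff₀ (by exact_mod_cast hn)] at this
  have hcd : c ≤ d := by
    refine ge_of_tendsto_of_frequently hlim ?_
    refine (h.and_eventually (eventually_gt_atTop 0)).mono ?_
    rintro n ⟨⟨I, hI, hIn, hcI⟩, hn⟩
    rw [le_div_iff₀ (by exact_mod_cast hn)]
    exact hcI.trans (Nat.cast_le.2 (hBmax n I hI hIn))
  have hpre : ∀ M : ℕ, ∃ S, F S ∧ ∀ m ≤ M, (d - 1 / (M + 1)) * m ≤ (S.filter (· < m)).card := by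
    intro M
    refine exists_prefix_dense hmono hshift M fun C => ?_
    obtain ⟨n, hn⟩ := exists_nat_gt (C * (M + 1))
    refine ⟨n, B n, (hB n).1, (hB n).2, ?_⟩
    have h1 := hdu n
    have hM : (0 : ℝ) < M + 1 := by positivity
    have h2 : C < 1 / (M + 1) * n := by
      rw [one_div_mul_eq_div, lt_div_iff₀ hM]
      exact hn
    simp only [hu] at h1
    linarith
  choose S hS hSd using hpre
  set U : Filter ℕ := (hyperfilter ℕ : Filter ℕ) with hU
  set J : Set ℕ := {i | ∀ᶠ M in U, i ∈ S M} with hJ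
  have hJS : ∀ m : ℕ, ∀ᶠ M in U, ∀ i ∈ Finset.range m, (i ∈ S M ↔ i ∈ J) := by
    intro m
    rw [Finset.eventually_all]
    intro i _
    by_cases hi : i ∈ J
    · have : ∀ᶠ M in U, i ∈ S M := hi
      filter_upwards [this] with M hM
      exact ⟨fun _ => hi, fun _ => hM⟩
    · have : ∀ᶠ M in U, ¬ i ∈ S M := Ultrafilter.eventually_not.2 hi
      filter_upwards [this] with M hM
      exact ⟨fun h => absurd h hM, fun h => absurd h hi⟩
  have hJF : ∀ I : Finset ℕ, ↑I ⊆ J → F I := by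
    intro I hI
    obtain ⟨m, hm⟩ := I.exists_nat_subset_range
    obtain ⟨M, hM⟩ := (hJS m).exists
    exact hmono (fun i hi => (hM i (hm hi)).2 (hI hi)) (hS M)
  refine ⟨J, hJF, d, (hc.trans_le hcd).ne', ?_⟩
  have hcard : ∀ m : ℕ, ∀ᶠ M in U, (S M).filter (· < m) = (Finset.range m).filter (· ∈ J) := by
    intro m
    filter_upwards [hJS m] with M hM
    ext i
    simp only [Finset.mem_filter, Finset.mem_range]
    constructor
    · exact fun h => ⟨h.2, (hM i (Finset.mem_range.2 h.2)).1 h.1⟩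
    · exact fun h => ⟨(hM i (Finset.mem_range.2 h.1)).2 h.2, h.1⟩
  have hlow : ∀ m : ℕ, d * m ≤ ((Finset.range m).filter (· ∈ J)).card := by
    intro m
    have ht : Tendsto (fun M : ℕ => (d - 1 / ((M : ℝ) + 1)) * m) U (nhds ((d - 0) * m)) :=
      ((tendsto_const_nhds.sub tendsto_one_div_add_atTop_nhds_zero_nat).mul_const _).mono_left
        Nat.hyperfilter_le_atTop
    rw [sub_zero] at ht
    refine le_of_tendsto ht ?_
    filter_upwards [hcard m, Nat.hyperfilter_le_atTop (eventually_ge_atTop m)] with M h1 h2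
    rw [← h1]
    exact hSd M m h2
  have hupp : ∀ m : ℕ, (((Finset.range m).filter (· ∈ J)).card : ℝ) ≤ u m := fun m =>
    Nat.cast_le.2 (hBmax m _ (hJF _ fun i hi => (Finset.mem_filter.1 hi).2)
      (Finset.filter_subset _ _))
  simp_rw [natCard_inter_Iic]
  refine tendsto_of_tendsto_of_tendsto_of_le_of_le tendsto_const_nhds
    (hlim.comp (tendsto_add_atTop_nat 1)) ?_ ?_
  · intro n
    have := hlow (n + 1)
    push_cast at this
    show d ≤ _ / ((n : ℝ) + 1)
    rwa [le_div_iff₀ (by positivity)]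
  · intro n
    have := hupp (n + 1)
    simp only [Function.comp, Nat.cast_add, Nat.cast_one]
    gcongr

theorem HasPosDensity.exists_eventually {J : Set ℕ} (hJ : HasPosDensity J) :
    ∃ c : ℝ, 0 < c ∧ ∀ᶠ n : ℕ in atTop, ∃ I : Finset ℕ,
      ↑I ⊆ J ∧ I ⊆ Finset.range n ∧ c * n ≤ I.card := by
  classical
  obtain ⟨d, hd, ht⟩ := hJ
  have hd0 : 0 < d := lt_of_le_of_ne (ge_of_tendsto' ht fun n => by positivity) hd.symm
  refine ⟨d / 2, by positivity, ?_⟩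
  have h1 := (tendsto_order.1 ht).1 (d / 2) (by linarith)
  rw [← map_add_atTop_eq_nat 1, eventually_map]
  filter_upwards [h1] with n hn
  refine ⟨(Finset.range (n + 1)).filter (· ∈ J), fun i hi => (Finset.mem_filter.1 hi).2,
    Finset.filter_subset _ _, ?_⟩
  rw [lt_div_iff₀ (by positivity), natCard_inter_Iic] at hn
  push_cast
  exact hn.le

/-- A family of at least `(3 / 2) ^ N` subsets of an `N`-element set
shatters a set of at least `N / 10` elements. -/
theorem exists_large_shattered {I : Finset ℕ} (𝒜 : Finset (Finset ℕ)) (hA : 𝒜 ⊆ I.powerset)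
    (hcard : 3 ^ I.card ≤ 2 ^ I.card * 𝒜.card) :
    ∃ s, 𝒜.Shatters s ∧ I.card ≤ 10 * s.card := by
  by_contra! hcon
  set N := I.card with hN
  have hne : 𝒜.Nonempty := by
    rw [← Finset.card_pos]
    by_contra! h0
    have : 0 < 3 ^ N := by positivity
    simp_all
  have hN0 : 0 < N := by
    have := hcon ∅ (Finset.shatters_empty.2 hne)
    simpa using this
  set d := N / 10 with hd
  have h1 : 𝒜.shatterer.card * 4 ^ (N - d) ≤ 5 ^ N := by
    calc 𝒜.shatterer.card * 4 ^ (N - d) = ∑ s ∈ 𝒜.shatterer, 4 ^ (N - d) := by simp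
      _ ≤ ∑ s ∈ 𝒜.shatterer, 1 ^ s.card * 4 ^ (N - s.card) := by
        refine Finset.sum_le_sum fun s hs => ?_
        rw [one_pow, one_mul]
        have := hcon s (Finset.mem_shatterer.1 hs)
        exact Nat.pow_le_pow_right (by norm_num) (by omega)
      _ ≤ ∑ s ∈ I.powerset, 1 ^ s.card * 4 ^ (N - s.card) := by
        refine Finset.sum_le_sum_of_subset fun s hs => ?_
        obtain ⟨t, ht, hst⟩ := (Finset.mem_shatterer.1 hs).exists_superset
        exact Finset.mem_powerset.2 (hst.trans (Finset.mem_powerset.1 (hA ht)))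
      _ = 5 ^ N := by rw [Finset.sum_pow_mul_eq_add_pow]
  have h2 : 12 ^ N ≤ 10 ^ N * 4 ^ d := by
    have h4 : 4 ^ (N - d) * 4 ^ d = 4 ^ N := by rw [← pow_add]; congr 1; omega
    calc 12 ^ N = 3 ^ N * 4 ^ N := by rw [← mul_pow]; norm_num
      _ ≤ (2 ^ N * 𝒜.shatterer.card) * 4 ^ N := by
        gcongr
        exact hcard.trans (Nat.mul_le_mul_left _ 𝒜.card_le_card_shatterer)
      _ = 2 ^ N * (𝒜.shatterer.card * 4 ^ (N - d)) * 4 ^ d := by rw [← h4]; ring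
      _ ≤ 2 ^ N * 5 ^ N * 4 ^ d := by gcongr
      _ = 10 ^ N * 4 ^ d := by rw [← mul_pow]; norm_num
  have h3 : 10 ^ N * 4 ^ d < 12 ^ N := by
    obtain ⟨r, hr⟩ : ∃ r, N = 10 * d + r := ⟨N % 10, by omega⟩
    have e1 : (10 : ℕ) ^ N * 4 ^ d = (10 ^ 10 * 4) ^ d * 10 ^ r := by
      rw [hr, pow_add, pow_mul, mul_pow]; ring
    have e2 : (12 : ℕ) ^ N = (12 ^ 10) ^ d * 12 ^ r := by rw [hr, pow_add, pow_mul]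
    rw [e1, e2]
    rcases Nat.eq_zero_or_pos d with h0 | h0
    · rw [h0, pow_zero, pow_zero, one_mul, one_mul]
      exact Nat.pow_lt_pow_left (by norm_num) (by omega)
    · refine Nat.mul_lt_mul_of_lt_of_le (Nat.pow_lt_pow_left (by norm_num) h0.ne')
        (Nat.pow_le_pow_left (by norm_num) r) (by positivity)
  omega

/-- If every `σ ⊆ I` is split into `β σ` and `σ \ β σ`, then on some `K ⊆ I` of proportional size
all subsets are traced with only the first part occurring, or all with only the second part. -/
theorem exists_large_monochromatic_shattered (I : Finset ℕ) (β : Finset ℕ → Finset ℕ)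
    (hβ : ∀ σ, β σ ⊆ σ) :
    ∃ K ⊆ I, I.card ≤ 20 * K.card ∧
      ((∀ t ⊆ K, ∃ σ ⊆ I, K ∩ σ = t ∧ t ⊆ β σ) ∨
        (∀ t ⊆ K, ∃ σ ⊆ I, K ∩ σ = t ∧ Disjoint t (β σ))) := by
  classical
  set 𝒮 : Finset ℕ → Finset (Finset ℕ) := fun J =>
    I.powerset.filter fun σ => β σ ⊆ J ∧ Disjoint J (σ \ β σ) with h𝒮
  obtain ⟨J, hJ⟩ : ∃ J, 3 ^ I.card ≤ 2 ^ I.card * (𝒮 J).card := by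
    by_contra! hcon
    have h1 : ∑ J ∈ I.powerset, (𝒮 J).card = ∑ σ ∈ I.powerset,
        (I.powerset.filter fun J => β σ ⊆ J ∧ Disjoint J (σ \ β σ)).card :=
      Finset.sum_card_bipartiteAbove_eq_sum_card_bipartiteBelow
        (fun J σ => β σ ⊆ J ∧ Disjoint J (σ \ β σ))
    have h2 : ∀ σ ∈ I.powerset, 1 ^ σ.card * 2 ^ (I.card - σ.card) ≤
        (I.powerset.filter fun J => β σ ⊆ J ∧ Disjoint J (σ \ β σ)).card := by
      intro σ hσ
      rw [Finset.mem_powerset] at hσ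
      have hsub : β σ ⊆ I \ (σ \ β σ) := by
        intro x hx
        have := hσ (hβ σ hx)
        simp [hx, this]
      rw [one_pow, one_mul]
      calc 2 ^ (I.card - σ.card) = (Finset.Icc (β σ) (I \ (σ \ β σ))).card := by
            rw [Finset.card_Icc_finset hsub,
              Finset.card_sdiff_of_subset (Finset.sdiff_subset.trans hσ),
              Finset.card_sdiff_of_subset (hβ σ)]
            have := Finset.card_le_card hσ
            have := Finset.card_le_card (hβ σ)
            congr 1
            omega
        _ ≤ _ := by
            refine Finset.card_le_card fun J hJ => ?_
            rw [Finset.mem_Icc, Finset.subset_sdiff] at hJ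
            simp [hJ]
    have h3 := Finset.sum_le_sum h2
    rw [Finset.sum_pow_mul_eq_add_pow, ← h1] at h3
    have h4 : ∑ J ∈ I.powerset, 2 ^ I.card * (𝒮 J).card < ∑ J ∈ I.powerset, 3 ^ I.card :=
      Finset.sum_lt_sum_of_nonempty ⟨∅, by simp⟩ fun J _ => hcon J
    rw [← Finset.mul_sum, Finset.sum_const, Finset.card_powerset, smul_eq_mul] at h4
    exact absurd (Nat.mul_le_mul_left (2 ^ I.card) h3) (not_le.2 (by simpa using h4))
  obtain ⟨s, hs, hIs⟩ := exists_large_shattered (𝒮 J) (Finset.filter_subset _ _) hJ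
  have hsI : s ⊆ I := by
    obtain ⟨t, ht, hst⟩ := hs.exists_superset
    exact hst.trans (Finset.mem_powerset.1 (Finset.mem_filter.1 ht).1)
  have hsplit := Finset.card_inter_add_card_sdiff s J
  rcases le_total (s \ J).card (s ∩ J).card with hle | hle
  · refine ⟨s ∩ J, Finset.inter_subset_left.trans hsI, by omega, Or.inl fun t ht => ?_⟩
    obtain ⟨σ, hσ, hσt⟩ := hs (ht.trans Finset.inter_subset_left)
    simp only [h𝒮, Finset.mem_filter, Finset.mem_powerset] at hσ
    refine ⟨σ, hσ.1, ?_, fun x hx => ?_⟩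
    · rw [Finset.inter_right_comm, hσt, Finset.inter_eq_left]
      exact ht.trans Finset.inter_subset_right
    · by_contra hxβ
      have hxσ : x ∈ σ := Finset.inter_subset_right (hσt ▸ hx)
      exact Finset.disjoint_left.1 hσ.2.2 (Finset.inter_subset_right (ht hx))
        (Finset.mem_sdiff.2 ⟨hxσ, hxβ⟩)
  · refine ⟨s \ J, Finset.sdiff_subset.trans hsI, by omega, Or.inr fun t ht => ?_⟩
    obtain ⟨σ, hσ, hσt⟩ := hs (ht.trans Finset.sdiff_subset)
    simp only [h𝒮, Finset.mem_filter, Finset.mem_powerset] at hσ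
    refine ⟨σ, hσ.1, ?_, Finset.disjoint_left.2 fun x hx hxβ => ?_⟩
    · rw [show s \ J ∩ σ = (s ∩ σ) \ J by grind, hσt, Finset.sdiff_eq_self_iff_disjoint]
      exact Finset.disjoint_left.2 fun x hx => (Finset.mem_sdiff.1 (ht hx)).2
    · exact (Finset.mem_sdiff.1 (ht hx)).2 (hσ.2.1 hxβ)

/-- A set of positive density has positive upper density intersection with one of its translates,
even when the intersection is thinned to avoid that translate of itself. -/
theorem exists_recurrent_difference {J : Set ℕ} (hJ : HasPosDensity J) {N : ℕ} (hN : 0 < N) :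
    ∃ n ≥ N, ∃ c : ℝ, 0 < c ∧ ∃ᶠ m : ℕ in atTop, ∃ K : Finset ℕ,
      K ⊆ Finset.range m ∧ c * m ≤ K.card ∧ ∀ s ∈ K, s ∈ J ∧ s + n ∈ J ∧ s + n ∉ K := by
  classical
  obtain ⟨c, hc, hI⟩ := hJ.exists_eventually
  obtain ⟨L, hL⟩ := exists_nat_gt (2 * N / c)
  have hN' : (1 : ℝ) ≤ N := by exact_mod_cast hN
  have hL0' : (0 : ℝ) < L := lt_of_le_of_lt (by positivity) hL
  have hL0 : 0 < L := by exact_mod_cast hL0'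
  rw [div_lt_iff₀ hc] at hL
  -- a block `{i | i / L = b}` is rich if it contains two elements of `J` at distance at least `N`
  set rich : ℕ → Prop := fun b => ∃ s n, N ≤ n ∧ s ∈ J ∧ s + n ∈ J ∧ s / L = b ∧ (s + n) / L = b
    with hrich
  have hex : ∀ b, ∃ s n, rich b →
      N ≤ n ∧ s ∈ J ∧ s + n ∈ J ∧ s / L = b ∧ (s + n) / L = b := by
    intro b
    by_cases hb : rich b
    · obtain ⟨s, n, h⟩ := hb
      exact ⟨s, n, fun _ => h⟩
    · exact ⟨0, 0, fun h => absurd h hb⟩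
  choose s n hsn using hex
  have hnL : ∀ b, rich b → n b < L := by
    intro b hb
    obtain ⟨-, -, -, h1, h2⟩ := hsn b hb
    rw [Nat.div_eq_iff hL0] at h1 h2
    omega
  by_contra! hcon
  have hcon' : ∀ᶠ m : ℕ in atTop, ∀ k ∈ Finset.range L, N ≤ k → ¬ ∃ K : Finset ℕ,
      K ⊆ Finset.range m ∧ 1 / (L : ℝ) ^ 3 * m ≤ K.card ∧
        ∀ s ∈ K, s ∈ J ∧ s + k ∈ J ∧ s + k ∉ K := by
    rw [Finset.eventually_all]
    intro k _
    by_cases hk : N ≤ k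
    · filter_upwards [hcon k hk (1 / (L : ℝ) ^ 3) (by positivity)] with m hm _
      rintro ⟨K, h1, h2, h3⟩
      obtain ⟨x, hx, h⟩ := hm K h1 h2
      exact (h3 x hx).2.2 (h (h3 x hx).1 (h3 x hx).2.1)
    · exact Eventually.of_forall fun m h => absurd h hk
  have hLm : Tendsto (fun m : ℕ => L * m) atTop atTop :=
    tendsto_id.const_mul_atTop' hL0
  obtain ⟨m, ⟨hm, I, hIJ, hIm, hcI⟩, hm0⟩ :=
    (((hLm.eventually hcon').and (hLm.eventually hI)).and (eventually_gt_atTop 0)).exists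
  set R := (Finset.range m).filter rich with hR
  have hblock : ∀ b, ((I.filter (fun i => i / L = b)).card : ℝ) ≤
      N + if rich b then (L : ℝ) else 0 := by
    intro b
    split_ifs with hb
    · have h1 : I.filter (fun i => i / L = b) ⊆ Finset.Ico (b * L) (b * L + L) := by
        intro i hi
        have := (Finset.mem_filter.1 hi).2
        rw [Nat.div_eq_iff hL0] at this
        rw [Finset.mem_Ico]
        omega
      have h2 := Finset.card_le_card h1
      rw [Nat.card_Ico, Nat.add_sub_cancel_left] at h2
      have h3 : ((I.filter (fun i => i / L = b)).card : ℝ) ≤ L := by exact_mod_cast h2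
      linarith
    · rcases (I.filter (fun i => i / L = b)).eq_empty_or_nonempty with h0 | h0
      · rw [h0]; simp
      · set a := (I.filter (fun i => i / L = b)).min' h0 with ha
        have hamem := Finset.mem_filter.1 (Finset.min'_mem _ h0)
        rw [← ha] at hamem
        have h1 : I.filter (fun i => i / L = b) ⊆ Finset.Ico a (a + N) := by
          intro i hi
          have hai := Finset.min'_le _ i hi
          rw [← ha] at hai
          rw [Finset.mem_Ico]
          refine ⟨hai, ?_⟩
          by_contra! hlt
          have hi' := Finset.mem_filter.1 hi
          refine hb ⟨a, i - a, by omega, hIJ hamem.1, ?_, hamem.2, ?_⟩ <;>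
            rw [Nat.add_sub_cancel' hai]
          exacts [hIJ hi'.1, hi'.2]
        have h2 := Finset.card_le_card h1
        rw [Nat.card_Ico, Nat.add_sub_cancel_left] at h2
        rw [add_zero]
        exact_mod_cast h2
  have hIcard : (I.card : ℝ) ≤ N * m + L * R.card := by
    have h1 : I.card = ∑ b ∈ Finset.range m, (I.filter (fun i => i / L = b)).card := by
      refine Finset.card_eq_sum_card_fiberwise fun i hi => ?_
      have := Finset.mem_range.1 (hIm hi)
      simpa using Nat.div_lt_of_lt_mul this
    rw [h1, Nat.cast_sum]
    refine (Finset.sum_le_sum fun b _ => hblock b).trans (le_of_eq ?_)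
    rw [Finset.sum_add_distrib, ← Finset.sum_filter, Finset.sum_const, Finset.sum_const,
      Finset.card_range, nsmul_eq_mul, nsmul_eq_mul]
    ring
  have hRcard : (m : ℝ) ≤ L * R.card := by
    have hm1 : (0 : ℝ) ≤ m := by positivity
    push_cast at hcI
    nlinarith [mul_le_mul_of_nonneg_right hL.le hm1, mul_le_mul_of_nonneg_right hN' hm1]
  obtain ⟨k, hk, hkR⟩ := Finset.exists_le_card_fiber_of_nsmul_le_card_of_maps_to (s := R)
    (t := Finset.range L) (f := n) (b := (R.card : ℝ) / L)
    (fun b hb => Finset.mem_range.2 (hnL b (Finset.mem_filter.1 hb).2))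
    ⟨0, Finset.mem_range.2 hL0⟩ (by
      rw [Finset.card_range, nsmul_eq_mul, mul_div_cancel₀ _ hL0'.ne'])
  set Q := R.filter (fun b => n b = k) with hQ
  have hQmem : ∀ b ∈ Q, b < m ∧ rich b ∧ n b = k := by
    intro b hb
    simp only [hQ, hR, Finset.mem_filter, Finset.mem_range] at hb
    exact ⟨hb.1.1, hb.1.2, hb.2⟩
  obtain ⟨b₀, hb₀⟩ : Q.Nonempty := by
    rw [← Finset.card_pos]
    have hRpos : (0 : ℝ) < R.card := by
      by_contra! h0
      have : (0 : ℝ) < m := by exact_mod_cast hm0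
      nlinarith
    exact_mod_cast (div_pos hRpos hL0').trans_le hkR
  obtain ⟨-, hb₀r, hb₀k⟩ := hQmem b₀ hb₀
  have hNk : N ≤ k := hb₀k ▸ (hsn b₀ hb₀r).1
  refine hm k hk hNk ⟨Q.image s, ?_, ?_, ?_⟩
  · intro x hx
    obtain ⟨b, hb, rfl⟩ := Finset.mem_image.1 hx
    obtain ⟨hbm, hbr, -⟩ := hQmem b hb
    have h1 := (hsn b hbr).2.2.2.1
    rw [Finset.mem_range]
    exact ((Nat.div_lt_iff_lt_mul hL0).1 (h1.trans_lt hbm)).trans_eq (mul_comm _ _)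
  · rw [Finset.card_image_of_injOn]
    · rw [div_le_iff₀ hL0'] at hkR
      rw [one_div_mul_eq_div, div_le_iff₀ (by positivity)]
      push_cast
      have := mul_le_mul_of_nonneg_left hkR hL0'.le
      nlinarith
    · intro b hb b' hb' hbb
      have h1 := (hsn b (hQmem b hb).2.1).2.2.2.1
      have h2 := (hsn b' (hQmem b' hb').2.1).2.2.2.1
      rw [← h1, ← h2]
      exact congrArg (· / L) hbb
  · intro x hx
    obtain ⟨b, hb, rfl⟩ := Finset.mem_image.1 hx
    obtain ⟨-, hbr, hbk⟩ := hQmem b hb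
    obtain ⟨-, h1, h2, h3, h4⟩ := hsn b hbr
    rw [hbk] at h2 h4
    refine ⟨h1, h2, fun h => ?_⟩
    obtain ⟨b', hb', hbb⟩ := Finset.mem_image.1 h
    have h5 := (hsn b' (hQmem b' hb').2.1).2.2.2.1
    have : b' = b := by rw [← h5, hbb, h4]
    subst this
    omega

section Independence

variable {X : Type*} {T : X → X} {k : ℕ} {A : Fin k → Set X}

theorem IsIndepSet.mono {J J' : Set ℕ} (h : IsIndepSet T A J') (hJ : J ⊆ J') :
    IsIndepSet T A J := fun I hI hIJ σ => h I hI (hIJ.trans hJ) σ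

theorem IsIndepSet.exists_mem [Nonempty X] {J : Set ℕ} (h : IsIndepSet T A J) (I : Finset ℕ)
    (hI : ↑I ⊆ J) (σ : ℕ → Fin k) : ∃ z, ∀ s ∈ I, T^[s] z ∈ A (σ s) := by
  rcases I.eq_empty_or_nonempty with rfl | hne
  · exact ⟨Classical.arbitrary X, by simp⟩
  · obtain ⟨z, hz⟩ := h I hne hI σ
    exact ⟨z, by simpa using hz⟩

theorem IsIndepSet.of_image_add {I : Finset ℕ} {n : ℕ}
    (h : IsIndepSet T A ↑(I.image (· + n))) : IsIndepSet T A ↑I := by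
  intro K hK hKI σ
  obtain ⟨z, hz⟩ := h (K.image (· + n)) (hK.image _)
    (Finset.coe_subset.2 (Finset.image_subset_image (Finset.coe_subset.1 hKI)))
    (fun i => σ (i - n))
  refine ⟨T^[n] z, ?_⟩
  simp only [Set.mem_iInter, Set.mem_preimage, Finset.mem_image, forall_exists_index, and_imp,
    forall_apply_eq_imp_iff₂, Nat.add_sub_cancel] at hz ⊢
  intro s hs
  rw [← Function.iterate_add_apply]
  exact hz s hs

theorem HasIndepSetPosDensity.of_frequently {c : ℝ} (hc : 0 < c)
    (h : ∃ᶠ n : ℕ in atTop, ∃ I : Finset ℕ,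
      IsIndepSet T A ↑I ∧ I ⊆ Finset.range n ∧ c * n ≤ I.card) :
    HasIndepSetPosDensity T A := by
  obtain ⟨J, hJ, hd⟩ := exists_hasPosDensity (F := fun I => IsIndepSet T A ↑I)
    (fun I J hIJ hJ => hJ.mono (Finset.coe_subset.2 hIJ)) (fun n I hI => hI.of_image_add) hc h
  exact ⟨J, fun I hI hIJ σ => hJ I hIJ I hI subset_rfl σ, hd⟩

theorem HasIndepSetPosDensity.mono {B : Fin k → Set X} (h : HasIndepSetPosDensity T A)
    (hAB : ∀ i, A i ⊆ B i) : HasIndepSetPosDensity T B := by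
  obtain ⟨J, hJ, hd⟩ := h
  refine ⟨J, fun I hI hIJ σ => (hJ I hI hIJ σ).mono ?_, hd⟩
  exact Set.iInter₂_mono fun s _ => Set.preimage_mono (hAB _)

theorem HasIndepSetPosDensity.nonempty (h : HasIndepSetPosDensity T A) (i : Fin k) :
    (A i).Nonempty := by
  obtain ⟨J, hJ, hd⟩ := h
  obtain ⟨c, hc, hI⟩ := hd.exists_eventually
  obtain ⟨n, ⟨I, hIJ, -, hIc⟩, hn⟩ := (hI.and (eventually_gt_atTop 0)).exists
  have hn' : (0 : ℝ) < n := by exact_mod_cast hn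
  have hIpos : (0 : ℝ) < I.card := (mul_pos hc hn').trans_le hIc
  have hIne : I.Nonempty := Finset.card_pos.1 (by exact_mod_cast hIpos)
  obtain ⟨z, hz⟩ := hJ I hIne hIJ fun _ => i
  obtain ⟨s, hs⟩ := hIne
  simp only [Set.mem_iInter] at hz
  exact ⟨_, hz s hs⟩

theorem HasIndepSetPosDensity.exists_return (h : HasIndepSetPosDensity T A) (a : Fin k → Fin k)
    (N : ℕ) : ∃ n ≥ N, HasIndepSetPosDensity T (fun i => A i ∩ T^[n] ⁻¹' A (a i)) := by
  classical
  obtain ⟨J, hJ, hd⟩ := h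
  obtain ⟨n, hn, c, hc, hK⟩ := exists_recurrent_difference hd (Nat.succ_pos N)
  refine ⟨n, (Nat.le_succ N).trans hn, .of_frequently hc (hK.mono ?_)⟩
  rintro m ⟨K, hKm, hcK, hKJ⟩
  refine ⟨K, fun I hI hIK σ => ?_, hKm, hcK⟩
  rw [Finset.coe_subset] at hIK
  obtain ⟨z, hz⟩ := hJ (I ∪ I.image (· + n)) (hI.mono Finset.subset_union_left) (by
      intro x hx
      simp only [Finset.coe_union, Finset.coe_image, Set.mem_union, Set.mem_image,
        Finset.mem_coe] at hx
      rcases hx with hx | ⟨x, hx, rfl⟩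
      · exact (hKJ x (hIK hx)).1
      · exact (hKJ x (hIK hx)).2.1)
    (fun i => if i ∈ I then σ i else a (σ (i - n)))
  simp only [Set.mem_iInter, Set.mem_preimage] at hz
  refine ⟨z, ?_⟩
  simp only [Set.mem_iInter]
  intro s hs
  refine ⟨?_, ?_⟩
  · have := hz s (Finset.mem_union_left _ hs)
    rwa [if_pos hs] at this
  · have := hz (s + n) (Finset.mem_union_right _ (Finset.mem_image_of_mem _ hs))
    rw [if_neg fun h => (hKJ s (hIK hs)).2.2 (hIK h), Nat.add_sub_cancel, add_comm,
      Function.iterate_add_apply] at this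
    exact this

theorem HasIndepSetPosDensity.swap {A B : Set X} (h : HasIndepSetPosDensity T ![A, B]) :
    HasIndepSetPosDensity T ![B, A] := by
  obtain ⟨J, hJ, hd⟩ := h
  refine ⟨J, fun I hI hIJ σ => (hJ I hI hIJ fun s => Fin.rev (σ s)).mono ?_, hd⟩
  refine Set.iInter₂_mono fun s _ => Set.preimage_mono ?_
  generalize σ s = i
  fin_cases i <;> simp [Fin.rev]

/-- Positive density of independence is partition regular in the first set. -/
theorem HasIndepSetPosDensity.of_union {A B C : Set X}
    (h : HasIndepSetPosDensity T ![B ∪ C, A]) :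
    HasIndepSetPosDensity T ![B, A] ∨ HasIndepSetPosDensity T ![C, A] := by
  classical
  have : Nonempty X := (h.nonempty 0).to_type
  obtain ⟨J, hJ, hd⟩ := h
  obtain ⟨c, hc, hI⟩ := hd.exists_eventually
  have hsplit : ∃ᶠ n : ℕ in atTop,
      (∃ I : Finset ℕ, IsIndepSet T ![B, A] ↑I ∧ I ⊆ Finset.range n ∧ c / 20 * n ≤ I.card) ∨
      (∃ I : Finset ℕ, IsIndepSet T ![C, A] ↑I ∧ I ⊆ Finset.range n ∧ c / 20 * n ≤ I.card) := by
    refine (hI.mono ?_).frequently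
    rintro n ⟨I, hIJ, hIn, hIc⟩
    have hz : ∀ σ : Finset ℕ, ∃ z, ∀ s ∈ I, T^[s] z ∈ ![B ∪ C, A] (if s ∈ σ then 0 else 1) :=
      fun σ => hJ.exists_mem I hIJ fun s => if s ∈ σ then 0 else 1
    choose z hz using hz
    have hzA : ∀ σ : Finset ℕ, ∀ s ∈ I, s ∉ σ → T^[s] (z σ) ∈ A := fun σ s hs hsσ => by
      simpa [hsσ] using hz σ s hs
    have hzBC : ∀ σ : Finset ℕ, ∀ s ∈ I, s ∈ σ → T^[s] (z σ) ∈ B ∪ C := fun σ s hs hsσ => by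
      simpa [hsσ] using hz σ s hs
    obtain ⟨K, hKI, hIK, hK⟩ := exists_large_monochromatic_shattered I
      (fun σ => σ.filter fun s => T^[s] (z σ) ∈ B) (fun σ => Finset.filter_subset _ _)
    have hcard : c / 20 * n ≤ K.card := by
      have : (I.card : ℝ) ≤ 20 * K.card := by exact_mod_cast hIK
      linarith
    have hindep : ∀ D : Set X, (∀ t ⊆ K, ∃ σ, K ∩ σ = t ∧ ∀ s ∈ t, T^[s] (z σ) ∈ D) →
        IsIndepSet T ![D, A] ↑K := by
      intro D hD L hL hLK τ
      obtain ⟨σ, hσ, hσD⟩ := hD (K.filter fun s => τ s = 0) (Finset.filter_subset _ _)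
      refine ⟨z σ, ?_⟩
      simp only [Set.mem_iInter, Set.mem_preimage]
      intro s hs
      have hsK : s ∈ K := hLK hs
      by_cases h0 : τ s = 0
      · rw [h0]
        exact hσD s (Finset.mem_filter.2 ⟨hsK, h0⟩)
      · rw [Fin.eq_one_of_ne_zero _ h0]
        refine hzA σ s (hKI hsK) fun hsσ => h0 ?_
        have : s ∈ K ∩ σ := Finset.mem_inter.2 ⟨hsK, hsσ⟩
        rw [hσ] at this
        exact (Finset.mem_filter.1 this).2
    rcases hK with hK | hK
    · refine Or.inl ⟨K, hindep B fun t ht => ?_, hKI.trans hIn, hcard⟩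
      obtain ⟨σ, -, hσ, hσt⟩ := hK t ht
      exact ⟨σ, hσ, fun s hs => (Finset.mem_filter.1 (hσt hs)).2⟩
    · refine Or.inr ⟨K, hindep C fun t ht => ?_, hKI.trans hIn, hcard⟩
      obtain ⟨σ, -, hσ, hσt⟩ := hK t ht
      refine ⟨σ, hσ, fun s hs => ?_⟩
      have hsσ : s ∈ σ := Finset.inter_subset_right (hσ ▸ hs)
      refine (hzBC σ s (hKI (ht hs)) hsσ).resolve_left fun hB => ?_
      exact Finset.disjoint_left.1 hσt hs (Finset.mem_filter.2 ⟨hsσ, hB⟩)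
  have hc' : 0 < c / 20 := by positivity
  exact (frequently_or_distrib.1 hsplit).imp (.of_frequently hc') (.of_frequently hc')

end Independence

section Topology

open Topology

/-- Compact sets with an independence set of positive density contain an IE-pair. -/
theorem HasIndepSetPosDensity.exists_isIETuple {X : Type*} [TopologicalSpace X] {T : X → X}
    {A B : Set X} (h : HasIndepSetPosDensity T ![A, B]) (hA : IsCompact A) (hB : IsCompact B) :
    ∃ x ∈ A, ∃ y ∈ B, IsIETuple T ![x, y] := by
  have hempty : ∀ C : Set X, ¬ HasIndepSetPosDensity T ![∅, C] := fun C hC =>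
    Set.not_nonempty_empty (hC.nonempty 0)
  have hmono : ∀ {C C' D D' : Set X}, C ⊆ C' → D ⊆ D' → HasIndepSetPosDensity T ![C, D] →
      HasIndepSetPosDensity T ![C', D'] := fun hC hD h =>
    h.mono (Fin.forall_fin_two.2 ⟨hC, hD⟩)
  obtain ⟨x, hxA, hx⟩ : ∃ x ∈ A, ∀ U ∈ 𝓝[A] x, HasIndepSetPosDensity T ![U, B] := by
    by_contra! hcon
    refine hA.induction_on (p := fun s => ¬ HasIndepSetPosDensity T ![s, B]) (hempty B)
      (fun s t hst ht hs => ht (hmono hst subset_rfl hs))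
      (fun s t hs ht hst => hst.of_union.elim hs ht) hcon h
  obtain ⟨y, hyB, hy⟩ : ∃ y ∈ B, ∀ V ∈ 𝓝[B] y, ∀ U ∈ 𝓝[A] x,
      HasIndepSetPosDensity T ![V, U] := by
    by_contra! hcon
    obtain ⟨U, hU, hUB⟩ := hB.induction_on
      (p := fun s => ∃ U ∈ 𝓝[A] x, ¬ HasIndepSetPosDensity T ![s, U])
      ⟨A, self_mem_nhdsWithin, hempty A⟩
      (fun s t hst ⟨U, hU, ht⟩ => ⟨U, hU, fun hs => ht (hmono hst subset_rfl hs)⟩)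
      (fun s t ⟨U, hU, hs⟩ ⟨V, hV, ht⟩ => ⟨U ∩ V, inter_mem hU hV, fun hst =>
        hst.of_union.elim (fun h => hs (hmono subset_rfl Set.inter_subset_left h))
          (fun h => ht (hmono subset_rfl Set.inter_subset_right h))⟩) hcon
    exact hUB (hx U hU).swap
  refine ⟨x, hxA, y, hyB, fun W hWo hW => ?_⟩
  have h0 : W 0 ∈ 𝓝[A] x := mem_nhdsWithin_of_mem_nhds ((hWo 0).mem_nhds (hW 0))
  have h1 : W 1 ∈ 𝓝[B] y := mem_nhdsWithin_of_mem_nhds ((hWo 1).mem_nhds (hW 1))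
  exact (hy _ h1 _ h0).swap.mono (Fin.forall_fin_two.2 ⟨subset_rfl, subset_rfl⟩)

theorem isClosed_setOf_isIETuple {X : Type*} [TopologicalSpace X] (T : X → X) :
    IsClosed {p : X × X | IsIETuple T ![p.1, p.2]} := by
  rw [← isOpen_compl_iff, isOpen_iff_mem_nhds]
  intro p hp
  simp only [Set.mem_compl_iff, Set.mem_ofPred_eq, IsIETuple, not_forall] at hp
  obtain ⟨U, hUo, hU, hnot⟩ := hp
  filter_upwards [prod_mem_nhds ((hUo 0).mem_nhds (hU 0)) ((hUo 1).mem_nhds (hU 1))] with q hq h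
  exact hnot (h U hUo (Fin.forall_fin_two.2 hq))

theorem IsIETuple.exists_return {X : Type*} [MetricSpace X] [CompactSpace X] {T : X → X}
    (hT : Continuous T) {x y : X} (h : IsIETuple T ![x, y]) (a : Fin 2 → Fin 2) {r : ℝ}
    (hr : 0 < r) (N : ℕ) :
    ∃ n ≥ N, ∃ x' y', IsIETuple T ![x', y'] ∧ dist x' x ≤ r ∧ dist y' y ≤ r ∧
      dist (T^[n] x') (![x, y] (a 0)) ≤ r ∧ dist (T^[n] y') (![x, y] (a 1)) ≤ r := by
  obtain ⟨n, hn, hind⟩ := (h (fun i => Metric.ball (![x, y] i) r) (fun i => Metric.isOpen_ball)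
    (fun i => Metric.mem_ball_self hr)).exists_return a N
  set C : Fin 2 → Set X := fun i =>
    Metric.closedBall (![x, y] i) r ∩ T^[n] ⁻¹' Metric.closedBall (![x, y] (a i)) r with hC
  have hCc : ∀ i, IsCompact (C i) := fun i =>
    (Metric.isClosed_closedBall.inter (Metric.isClosed_closedBall.preimage
      (hT.iterate n))).isCompact
  have hCind : HasIndepSetPosDensity T ![C 0, C 1] := by
    refine hind.mono fun i => ?_
    have : (![C 0, C 1] : Fin 2 → Set X) i = C i := by fin_cases i <;> rfl
    rw [this]
    exact Set.inter_subset_inter Metric.ball_subset_closedBall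
      (Set.preimage_mono Metric.ball_subset_closedBall)
  obtain ⟨x', hx', y', hy', hIE⟩ := hCind.exists_isIETuple (hCc 0) (hCc 1)
  exact ⟨n, hn, x', y', hIE, hx'.1, hy'.1, hx'.2, hy'.2⟩

end Topology

/-- Corollary `C-proximal`: the Li–Yorke pairs which are IE-pairs are dense
in `IE₂(X,T) \ Δ₂(X)`. -/
theorem stmt13 {X : Type*} [MetricSpace X] [CompactSpace X]
    (T : X → X) (hT : Continuous T) (hTs : Function.Surjective T) :
    {p : X × X | IsIETuple T ![p.1, p.2]} \ {p : X × X | p.1 = p.2} ⊆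
      closure ({p : X × X |
          0 < Filter.limsup (fun n : ℕ => dist (T^[n] p.1) (T^[n] p.2)) atTop ∧
          Filter.liminf (fun n : ℕ => dist (T^[n] p.1) (T^[n] p.2)) atTop = 0} ∩
        {p : X × X | IsIETuple T ![p.1, p.2]}) := by
  set E : Set (X × X) := {p : X × X | IsIETuple T ![p.1, p.2]} \ {p : X × X | p.1 = p.2} with hE
  have hEloc : IsLocallyClosed E :=
    (isClosed_setOf_isIETuple T).isLocallyClosed.inter
      (isClosed_eq continuous_fst continuous_snd).isOpen_compl.isLocallyClosed
  have : LocallyCompactSpace E := hEloc.locallyCompactSpace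
  set δ : ℕ → E → ℝ := fun n p => dist (T^[n] p.1.1) (T^[n] p.1.2) with hδ
  have hδc : ∀ n, Continuous (δ n) := fun n => by
    have := hT.iterate n
    fun_prop
  set O : ℕ → Set E := fun N => {p | ∃ n ≥ N, δ n p < 1 / (N + 1)} with hO
  set P : ℕ → Set E := fun N => {p | ∃ n ≥ N, δ 0 p / 2 < δ n p} with hP
  have hOo : ∀ N, IsOpen (O N) := fun N => by
    have : O N = ⋃ n ≥ N, {p | δ n p < 1 / (N + 1)} := by ext; simp [hO]
    rw [this]
    exact isOpen_biUnion fun n _ => isOpen_lt (hδc n) continuous_const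
  have hPo : ∀ N, IsOpen (P N) := fun N => by
    have : P N = ⋃ n ≥ N, {p | δ 0 p / 2 < δ n p} := by ext; simp [hP]
    rw [this]
    exact isOpen_biUnion fun n _ => isOpen_lt ((hδc 0).div_const 2) (hδc n)
  have hreturn : ∀ (a : Fin 2 → Fin 2) (p : E) (N : ℕ) (r : ℝ), 0 < r → r < δ 0 p / 2 →
      ∃ n ≥ N, ∃ q : E, dist q p ≤ r ∧ dist (T^[n] q.1.1) (![p.1.1, p.1.2] (a 0)) ≤ r ∧
        dist (T^[n] q.1.2) (![p.1.1, p.1.2] (a 1)) ≤ r := by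
    rintro a ⟨⟨x, y⟩, hp⟩ N r hr hrp
    obtain ⟨n, hn, x', y', hIE, h1, h2, h3, h4⟩ := hp.1.exists_return hT a hr N
    have hne : x' ≠ y' := by
      rintro rfl
      have := dist_triangle_left x y x'
      simp only [hδ, Function.iterate_zero, id] at hrp
      linarith
    exact ⟨n, hn, ⟨(x', y'), hIE, hne⟩, max_le h1 h2, h3, h4⟩
  have hpos : ∀ p : E, 0 < δ 0 p := fun p => dist_pos.2 p.2.2
  have hOd : ∀ N, Dense (O N) := fun N => by
    refine Metric.dense_iff.2 fun p ε hε => ?_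
    have hN : (0 : ℝ) < 1 / (N + 1) := by positivity
    obtain ⟨r, hr, hr'⟩ := exists_between
      (lt_min (lt_min (half_pos (hpos p)) hε) (half_pos hN))
    simp only [lt_min_iff] at hr'
    obtain ⟨n, hn, q, hq, h1, h2⟩ := hreturn ![0, 0] p N r hr hr'.1.1
    refine ⟨q, hq.trans_lt hr'.1.2, n, hn, ?_⟩
    have := dist_triangle_right (T^[n] q.1.1) (T^[n] q.1.2) p.1.1
    simp only [Matrix.cons_val_zero, Matrix.cons_val_one] at h1 h2
    simp only [hδ]
    linarith
  have hPd : ∀ N, Dense (P N) := fun N => by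
    refine Metric.dense_iff.2 fun p ε hε => ?_
    obtain ⟨r, hr, hr'⟩ := exists_between
      (lt_min (div_pos (hpos p) (by norm_num : (0 : ℝ) < 6)) hε)
    simp only [lt_min_iff] at hr'
    obtain ⟨n, hn, q, hq, h1, h2⟩ := hreturn ![0, 1] p N r hr (by linarith [hpos p])
    refine ⟨q, hq.trans_lt hr'.2, n, hn, ?_⟩
    have hq1 : dist q.1.1 p.1.1 ≤ r := (le_max_left _ _).trans hq
    have hq2 : dist q.1.2 p.1.2 ≤ r := (le_max_right _ _).trans hq
    have h3 := dist_triangle4_right p.1.1 p.1.2 (T^[n] q.1.1) (T^[n] q.1.2)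
    have h4 := dist_triangle4_right q.1.1 q.1.2 p.1.1 p.1.2
    simp only [Matrix.cons_val_zero, Matrix.cons_val_one] at h1 h2
    rw [dist_comm p.1.1 (T^[n] _), dist_comm p.1.2 (T^[n] _)] at h3
    simp only [hδ, Function.iterate_zero, id] at hr' ⊢
    linarith
  have hdense : Dense ((⋂ N, O N) ∩ ⋂ N, P N) :=
    (dense_iInter_of_isOpen hOo hOd).inter_of_Gδ
      (IsGδ.iInter_of_isOpen hOo) (IsGδ.iInter_of_isOpen hPo) (dense_iInter_of_isOpen hPo hPd)
  intro p hp
  have hcl : p ∈ closure (Subtype.val '' ((⋂ N, O N) ∩ ⋂ N, P N)) :=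
    image_closure_subset_closure_image continuous_subtype_val ⟨⟨p, hp⟩, hdense _, rfl⟩
  refine closure_mono ?_ hcl
  rintro _ ⟨q, ⟨hqO, hqP⟩, rfl⟩
  rw [Set.mem_iInter] at hqO hqP
  have hbdd : ∀ n : ℕ, δ n q ≤ Metric.diam (Set.univ : Set X) := fun n =>
    Metric.dist_le_diam_of_mem isCompact_univ.isBounded (Set.mem_univ _) (Set.mem_univ _)
  have habove : IsBoundedUnder (· ≤ ·) atTop (fun n => δ n q) := isBoundedUnder_of ⟨_, hbdd⟩
  have hbelow : IsBoundedUnder (· ≥ ·) atTop (fun n => δ n q) :=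
    isBoundedUnder_of ⟨0, fun n => dist_nonneg⟩
  refine ⟨⟨(half_pos (hpos q)).trans_le ?_, le_antisymm ?_ ?_⟩, q.2.1⟩
  · refine le_limsup_of_frequently_le (frequently_atTop.2 fun N => ?_) habove
    obtain ⟨n, hn, h⟩ := hqP N
    exact ⟨n, hn, h.le⟩
  · refine le_of_forall_pos_le_add fun ε hε => ?_
    rw [zero_add]
    refine liminf_le_of_frequently_le (frequently_atTop.2 fun N => ?_) hbelow
    obtain ⟨M, hM⟩ := exists_nat_one_div_lt hε
    obtain ⟨n, hn, h⟩ := hqO (max M N)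
    refine ⟨n, (le_max_right _ _).trans hn, h.le.trans (le_trans ?_ hM.le)⟩
    gcongr
    exact le_max_left _ _
  · exact le_liminf_of_le habove.isCoboundedUnder_ge (Eventually.of_forall fun n => dist_nonneg)
end

section
/- Let (X, G) be a dynamical system and let f ∈ C(X). Then f is nonnull if and only if there exists an IN-pair (x, y) with f(x) ≠ f(y). -/
open Filter Set

/-- `J ⊆ G` is an independence set for the tuple `A = (A 0, …, A (k-1))` of subsets
of `X`. -/
def IsIndepSetG {G : Type*} [Monoid G] {X : Type*} [MulAction G X]
    {k : ℕ} (A : Fin k → Set X) (J : Set G) : Prop :=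
  ∀ I : Finset G, I.Nonempty → ↑I ⊆ J → ∀ σ : G → Fin k,
    (⋂ s ∈ I, (fun x : X => s • x) ⁻¹' A (σ s)).Nonempty

/-- `x` is an IN-tuple: every product neighbourhood of `x` has arbitrarily large finite
independence sets. -/
def IsINTuple (G : Type*) [Monoid G] {X : Type*} [TopologicalSpace X] [MulAction G X]
    {k : ℕ} (x : Fin k → X) : Prop :=
  ∀ U : Fin k → Set X, (∀ i, IsOpen (U i)) → (∀ i, x i ∈ U i) →
    ∀ n : ℕ, ∃ I : Finset G, n ≤ I.card ∧ IsIndepSetG U (↑I : Set G)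

/-- `x` is an IT-tuple: every product neighbourhood of `x` has an infinite independence
set. -/
def IsITTuple (G : Type*) [Monoid G] {X : Type*} [TopologicalSpace X] [MulAction G X]
    {k : ℕ} (x : Fin k → X) : Prop :=
  ∀ U : Fin k → Set X, (∀ i, IsOpen (U i)) → (∀ i, x i ∈ U i) →
    ∃ J : Set G, J.Infinite ∧ IsIndepSetG U J

/-- Ramsey's theorem for colourings of `k`-element subsets with finitely many colours. -/
theorem exists_card_le_homogeneous {α κ : Type*} [LinearOrder α] [Finite κ] (k : ℕ) :
    ∀ m : ℕ, ∃ N : ℕ, ∀ V : Finset α, N ≤ V.card → ∀ C : Finset α → κ,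
      ∃ W ⊆ V, m ≤ W.card ∧ ∃ c, ∀ e ⊆ W, e.card = k → C e = c := by
  induction k with
  | zero =>
    intro m
    refine ⟨m, fun V hV C => ⟨V, subset_rfl, hV, C ∅, fun e _ he => ?_⟩⟩
    rw [Finset.card_eq_zero.1 he]
  | succ k ih =>
    have key : ∀ t : ℕ, ∃ N : ℕ, ∀ V : Finset α, N ≤ V.card → ∀ C : Finset α → κ,
        ∃ W ⊆ V, t ≤ W.card ∧ ∃ χ : α → κ, ∀ v ∈ W, ∀ e ⊆ W, (∀ u ∈ e, v < u) →
          e.card = k → C (insert v e) = χ v := by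
      intro t
      induction t with
      | zero =>
        exact ⟨0, fun V _ C => ⟨∅, by simp, by simp, fun _ => C ∅, by simp⟩⟩
      | succ t iht =>
        obtain ⟨N', hN'⟩ := iht
        obtain ⟨N, hN⟩ := ih N'
        refine ⟨N + 1, fun V hV C => ?_⟩
        have hne : V.Nonempty := Finset.card_pos.1 (by omega)
        set v := V.min' hne with hv
        have hvV : v ∈ V := V.min'_mem hne
        obtain ⟨S, hSV, hS, c, hc⟩ := hN (V.erase v)
          (by rw [Finset.card_erase_of_mem hvV]; omega) (fun e => C (insert v e))
        obtain ⟨W, hWS, hW, χ, hχ⟩ := hN' S hS C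
        have hlt : ∀ u ∈ W, v < u := fun u hu => by
          have := hSV (hWS hu)
          exact lt_of_le_of_ne (V.min'_le u (Finset.mem_of_mem_erase this))
            (Finset.ne_of_mem_erase this).symm
        have hvW : v ∉ W := fun h => lt_irrefl _ (hlt v h)
        refine ⟨insert v W, ?_, ?_, Function.update χ v c, ?_⟩
        · exact Finset.insert_subset hvV
            ((hWS.trans hSV).trans (Finset.erase_subset _ _))
        · rw [Finset.card_insert_of_notMem hvW]; omega
        · intro u hu e he hue hek
          have hvu : v ≤ u := by
            rcases Finset.mem_insert.1 hu with rfl | h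
            · exact le_rfl
            · exact (hlt u h).le
          have heW : e ⊆ W := fun z hz => by
            rcases Finset.mem_insert.1 (he hz) with rfl | h
            · exact absurd (hue _ hz) (not_lt.2 hvu)
            · exact h
          by_cases huv : u = v
          · subst huv
            rw [Function.update_self]
            exact hc e (heW.trans hWS) hek
          · rw [Function.update_of_ne huv]
            exact hχ u ((Finset.mem_insert.1 hu).resolve_left huv) e heW hue hek
    intro m
    have := Fintype.ofFinite κ
    classical
    obtain ⟨N, hN⟩ := key (Fintype.card κ * m)
    refine ⟨N, fun V hV C => ?_⟩
    obtain ⟨W, hWV, hW, χ, hχ⟩ := hN V hV C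
    have : Nonempty κ := ⟨C ∅⟩
    obtain ⟨c, -, hc⟩ := Finset.exists_le_card_fiber_of_mul_le_card_of_maps_to
      (f := χ) (s := W) (t := Finset.univ) (fun _ _ => Finset.mem_univ _)
      Finset.univ_nonempty (by simpa using hW)
    refine ⟨W.filter (fun x => χ x = c), (Finset.filter_subset _ _).trans hWV, hc, c, ?_⟩
    intro e he hek
    have hne : e.Nonempty := Finset.card_pos.1 (by omega)
    have hmem := e.min'_mem hne
    have h := hχ (e.min' hne) (Finset.mem_filter.1 (he hmem)).1 (e.erase (e.min' hne))
      ((Finset.erase_subset _ _).trans (he.trans (Finset.filter_subset _ _)))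
      (fun u hu => e.min'_lt_of_mem_erase_min' hne hu)
      (by rw [Finset.card_erase_of_mem hmem]; omega)
    rw [Finset.insert_erase hmem] at h
    rw [h, (Finset.mem_filter.1 (he hmem)).2]

/-- Ramsey's theorem for colourings of increasing `k`-tuples. -/
theorem exists_strictMono_homogeneous {α κ : Type*} [LinearOrder α] [Finite κ] [Nonempty κ]
    (k m : ℕ) : ∃ N : ℕ, ∀ V : Finset α, N ≤ V.card → ∀ C : (Fin k → α) → κ,
      ∃ w : Fin m → α, StrictMono w ∧ (∀ i, w i ∈ V) ∧
        ∃ c, ∀ p : Fin k → Fin m, StrictMono p → C (w ∘ p) = c := by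
  obtain ⟨N, hN⟩ := exists_card_le_homogeneous (α := α) (κ := κ) k m
  refine ⟨N, fun V hV C => ?_⟩
  obtain ⟨W, hWV, hW, c, hc⟩ := hN V hV
    (fun e => if h : e.card = k then C (e.orderEmbOfFin h) else Classical.arbitrary κ)
  obtain ⟨W', hW', hcard⟩ := Finset.exists_subset_card_eq hW
  refine ⟨W'.orderEmbOfFin hcard, (W'.orderEmbOfFin hcard).strictMono,
    fun i => hWV (hW' (W'.orderEmbOfFin_mem hcard i)), c, fun p hp => ?_⟩
  set q : Fin k → α := W'.orderEmbOfFin hcard ∘ p with hq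
  have hqm : StrictMono q := (W'.orderEmbOfFin hcard).strictMono.comp hp
  have hk : (Finset.univ.image q).card = k := by
    rw [Finset.card_image_of_injective _ hqm.injective, Finset.card_fin]
  have h := hc (Finset.univ.image q) (fun z hz => by
    obtain ⟨i, -, rfl⟩ := Finset.mem_image.1 hz
    exact hW' (W'.orderEmbOfFin_mem hcard _)) hk
  rw [dif_pos hk, ← Finset.orderEmbOfFin_unique hk (f := q) (by simp) hqm] at h
  exact h

/-- If every increasing `2m`-tuple of a long sequence admits a point alternating between `U` and
`V`, then some `m` terms of the sequence are independent for `(U, V)`. -/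
theorem exists_isIndepSetG_of_alternating {G : Type*} [Monoid G] [LinearOrder G] {X : Type*}
    [MulAction G X] (U V : Set X) {m n : ℕ} (hn : 3 * m ≤ n) (w : Fin n → G)
    (hw : StrictMono w)
    (h : ∀ p : Fin (2 * m) → Fin n, StrictMono p →
      ∃ x : X, ∀ i : Fin (2 * m), w (p i) • x ∈ if (i : ℕ) % 2 = 0 then U else V) :
    ∃ J : Finset G, J.card = m ∧ IsIndepSetG ![U, V] (↑J : Set G) := by
  let a : Fin m → Fin n := fun j => ⟨3 * j + 1, by omega⟩
  have ha : Function.Injective (w ∘ a) := hw.injective.comp fun i j hij => by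
    simp only [a, Fin.mk.injEq] at hij
    exact Fin.ext (by omega)
  refine ⟨Finset.univ.image (w ∘ a), ?_, fun I _ hI σ => ?_⟩
  · rw [Finset.card_image_of_injective _ ha, Finset.card_fin]
  let d : Fin m → ℕ := fun j => if σ (w (a j)) = 0 then 1 else 0
  have hd : ∀ j, d j ≤ 1 := fun j => by simp only [d]; split_ifs <;> simp
  let b : Fin (2 * m) → Fin m := fun i => ⟨i / 2, by omega⟩
  obtain ⟨x, hx⟩ := h (fun i => ⟨3 * (i / 2 : ℕ) + i % 2 + d (b i), by
      have := hd (b i); omega⟩) (fun i j hij => by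
    have hij' : (i : ℕ) < j := hij
    rw [Fin.mk_lt_mk]
    by_cases hb : (i / 2 : ℕ) = j / 2
    · have : b i = b j := Fin.ext hb
      rw [this]
      omega
    · have := hd (b i)
      omega)
  refine ⟨x, Set.mem_iInter₂.2 fun s hs => ?_⟩
  have hsJ := hI hs
  simp only [Finset.coe_image, Finset.coe_univ, Set.image_univ, Set.mem_range,
    Function.comp_apply] at hsJ
  obtain ⟨j, rfl⟩ := hsJ
  have h_two : ∀ z : Fin 2, z = 0 ∨ z = 1 := by decide
  rcases h_two (σ (w (a j))) with hσ | hσ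
  · have h1 := hx ⟨2 * j, by omega⟩
    have hb : b ⟨2 * j, by omega⟩ = j := Fin.ext (by simp [b])
    have hdj : d j = 1 := by simp [d, hσ]
    rw [if_pos (by simp)] at h1
    rw [Set.mem_preimage, hσ]
    have heq : a j = ⟨3 * (2 * j / 2 : ℕ) + 2 * j % 2 + d (b ⟨2 * j, by omega⟩), by
        rw [hb, hdj]; omega⟩ := by
      rw [Fin.ext_iff]
      simp only [a, hb, hdj]
      omega
    rw [heq]
    exact h1
  · have h1 := hx ⟨2 * j + 1, by omega⟩
    have hb : b ⟨2 * j + 1, by omega⟩ = j := Fin.ext (by simp only [b]; omega)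
    have hdj : d j = 0 := by simp [d, hσ]
    rw [if_neg (by simp)] at h1
    rw [Set.mem_preimage, hσ]
    have heq : a j = ⟨3 * ((2 * j + 1) / 2 : ℕ) + (2 * j + 1) % 2 +
        d (b ⟨2 * j + 1, by omega⟩), by rw [hb, hdj]; omega⟩ := by
      rw [Fin.ext_iff]
      simp only [a, hb, hdj]
      omega
    rw [heq]
    exact h1

/-- `m` disjoint pairs of consecutive terms, the first in `U` and the second in `V`, form an
alternating `2m`-tuple. -/
theorem exists_strictMono_alternating {X : Type*} (U V : Set X) {m T : ℕ}
    (y : Fin (2 * T) → X) (B : Finset (Fin T)) (hB : m ≤ B.card)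
    (hU : ∀ i ∈ B, y ⟨2 * i, by omega⟩ ∈ U) (hV : ∀ i ∈ B, y ⟨2 * i + 1, by omega⟩ ∈ V) :
    ∃ p : Fin (2 * m) → Fin (2 * T), StrictMono p ∧
      ∀ i : Fin (2 * m), y (p i) ∈ if (i : ℕ) % 2 = 0 then U else V := by
  obtain ⟨B', hB', hcard⟩ := Finset.exists_subset_card_eq hB
  let b := B'.orderEmbOfFin hcard
  have hb : ∀ i, b i ∈ B := fun i => hB' (B'.orderEmbOfFin_mem hcard i)
  let q : Fin (2 * m) → Fin m := fun i => ⟨i / 2, by omega⟩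
  refine ⟨fun i => ⟨2 * b (q i) + i % 2, by omega⟩, fun i j hij => ?_, fun i => ?_⟩
  · have hij' : (i : ℕ) < j := hij
    rw [Fin.mk_lt_mk]
    by_cases hq : (i / 2 : ℕ) = j / 2
    · have : q i = q j := Fin.ext hq
      rw [this]
      omega
    · have h1 : q i < q j := Fin.mk_lt_mk.2 (by omega)
      have h2 : ((b (q i) : Fin T) : ℕ) < b (q j) := b.strictMono h1
      omega
  · split_ifs with hi
    · convert hU _ (hb (q i)) using 3
      rw [hi, add_zero]
    · convert hV _ (hb (q i)) using 3
      omega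

theorem exists_coeff_of_injective {G E ι : Type*} [AddCommMonoid E] [Module ℂ E] [Fintype ι]
    {w : ι → G} (hw : Function.Injective w) (I : Finset G) (hI : ∀ i, w i ∈ I) (ε : ι → ℂ) :
    ∃ c : G → ℂ, (∀ F : G → E, ∑ s ∈ I, c s • F s = ∑ i, ε i • F (w i)) ∧
      ∑ s ∈ I, ‖c s‖ = ∑ i, ‖ε i‖ := by
  classical
  have hz : ∀ s, s ∉ Finset.univ.map ⟨w, hw⟩ → Function.extend w ε 0 s = 0 := fun s hs => by
    rw [Function.extend_apply']
    · rfl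
    · rintro ⟨i, rfl⟩
      exact hs (Finset.mem_map_of_mem ⟨w, hw⟩ (Finset.mem_univ i))
  have hsub : Finset.univ.map ⟨w, hw⟩ ⊆ I := fun s hs => by
    obtain ⟨i, -, rfl⟩ := Finset.mem_map.1 hs
    exact hI i
  refine ⟨Function.extend w ε 0, fun F => ?_, ?_⟩
  · rw [← Finset.sum_subset hsub fun s _ hs => by rw [hz s hs, zero_smul], Finset.sum_map]
    simp [hw.extend_apply]
  · rw [← Finset.sum_subset hsub fun s _ hs => by rw [hz s hs, norm_zero], Finset.sum_map]
    simp [hw.extend_apply]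

theorem exists_finite_cover_of_not_isINTuple {G : Type*} [Monoid G] {X : Type*}
    [TopologicalSpace X] [CompactSpace X] [MulAction G X] (f : C(X, ℂ)) {δ : ℝ}
    (h : ∀ x y : X, δ ≤ ‖f x - f y‖ → ¬ IsINTuple G ![x, y]) :
    ∃ (t : Finset (X × X)) (U V : X × X → Set X) (m : ℕ),
      (∀ x y, δ ≤ ‖f x - f y‖ → ∃ z ∈ t, x ∈ U z ∧ y ∈ V z) ∧
      ∀ z ∈ t, ∀ J : Finset G, J.card = m → ¬ IsIndepSetG ![U z, V z] (↑J : Set G) := by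
  let K : Set (X × X) := {z | δ ≤ ‖f z.1 - f z.2‖}
  have hK : IsCompact K := (isClosed_le continuous_const (by fun_prop)).isCompact
  have hz : ∀ z : X × X, ∃ (U V : Set X) (n : ℕ), z ∈ K →
      IsOpen U ∧ IsOpen V ∧ z.1 ∈ U ∧ z.2 ∈ V ∧
      ∀ J : Finset G, n ≤ J.card → ¬ IsIndepSetG ![U, V] (↑J : Set G) := by
    intro z
    by_cases hzK : z ∈ K
    · have := h z.1 z.2 hzK
      unfold IsINTuple at this
      push Not at this
      obtain ⟨U, hU, hzU, n, hn⟩ := this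
      refine ⟨U 0, U 1, n, fun _ => ⟨hU 0, hU 1, hzU 0, hzU 1, fun J hJ => ?_⟩⟩
      have hU2 : ![U 0, U 1] = U := by
        ext i : 1
        fin_cases i <;> rfl
      rw [hU2]
      exact hn J hJ
    · exact ⟨∅, ∅, 0, fun h => absurd h hzK⟩
  choose U V n hUV using hz
  obtain ⟨t, htK, ht⟩ := hK.elim_nhds_subcover (fun z => U z ×ˢ V z) fun z hz =>
    ((hUV z hz).1.prod (hUV z hz).2.1).mem_nhds ⟨(hUV z hz).2.2.1, (hUV z hz).2.2.2.1⟩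
  refine ⟨t, U, V, t.sup n, fun x y hxy => ?_, fun z hz J hJ => ?_⟩
  · obtain ⟨z, hz, hmem⟩ := Set.mem_iUnion₂.1 (ht (show (x, y) ∈ K from hxy))
    exact ⟨z, hz, hmem⟩
  · exact (hUV z (htK z hz)).2.2.2.2 J (hJ ▸ Finset.le_sup hz)

theorem exists_isINTuple_of_l1_isomorphism {G : Type*} [Monoid G] {X : Type*}
    [TopologicalSpace X] [CompactSpace X] [MulAction G X]
    (hc : ∀ s : G, Continuous fun x : X => s • x) (f : C(X, ℂ)) {lam : ℝ} (hlam : 1 ≤ lam)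
    (h : ∀ n : ℕ, ∃ I : Finset G, n ≤ I.card ∧ ∀ c : G → ℂ,
      lam⁻¹ * ∑ s ∈ I, ‖c s‖ ≤ ‖∑ s ∈ I, c s • f.comp ⟨fun x : X => s • x, hc s⟩‖) :
    ∃ x y : X, IsINTuple G ![x, y] ∧ f x ≠ f y := by
  by_contra! hcon
  have hpos : 0 < lam⁻¹ := by positivity
  obtain ⟨t, U, V, m, hcov, hind⟩ := exists_finite_cover_of_not_isINTuple (G := G) f
    (δ := lam⁻¹) (fun x y hxy hIN => by
      rw [hcon x y hIN, sub_self, norm_zero] at hxy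
      exact absurd hpos (not_lt.2 hxy))
  let : LinearOrder G := IsWellOrder.linearOrder WellOrderingRel
  obtain ⟨T₀, hT₀⟩ := exists_nat_gt (lam * ((t.card * m : ℕ) * (2 * ‖f‖)))
  obtain ⟨T, hTm, hT⟩ : ∃ T : ℕ, 3 * m ≤ 2 * T ∧ lam * ((t.card * m : ℕ) * (2 * ‖f‖)) < T := by
    refine ⟨T₀ + 3 * m, by omega, hT₀.trans_le ?_⟩
    exact_mod_cast Nat.le_add_right _ _
  obtain ⟨N, hN⟩ := exists_strictMono_homogeneous (α := G) (κ := t → Prop) (2 * m) (2 * T)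
  obtain ⟨I, hNI, hI⟩ := h N
  obtain ⟨w, hw, hwI, col, hcol⟩ := hN I hNI fun q z =>
    ∃ x : X, ∀ i : Fin (2 * m), q i • x ∈ if (i : ℕ) % 2 = 0 then U z else V z
  have hnot : ∀ z : t, ∀ p : Fin (2 * m) → Fin (2 * T), StrictMono p →
      ¬ ∃ x : X, ∀ i : Fin (2 * m), w (p i) • x ∈ if (i : ℕ) % 2 = 0 then U z else V z := by
    intro z p hp hx
    obtain ⟨J, hJ, hJi⟩ := exists_isIndepSetG_of_alternating (U z) (V z) hTm w hw
      fun p' hp' => by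
        have h1 := congrFun ((hcol p' hp').trans (hcol p hp).symm) z
        exact h1.mpr hx
    exact hind z z.2 J hJ hJi
  let v : Fin T × Bool → Fin (2 * T) := fun i => ⟨2 * i.1 + i.2.toNat, by
    have := i.2.toNat_le; omega⟩
  have hv : Function.Injective v := by
    rintro ⟨i, a⟩ ⟨j, b⟩ hij
    simp only [v, Fin.mk.injEq] at hij
    have := a.toNat_le
    have := b.toNat_le
    have hab : a = b := by
      cases a <;> cases b <;> simp_all <;> omega
    exact Prod.ext (Fin.ext (by simp only; omega)) hab
  obtain ⟨c, hc1, hc2⟩ := exists_coeff_of_injective (E := C(X, ℂ)) (hw.injective.comp hv) I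
    (fun i => hwI _) (fun i => if i.2 then -1 else 1)
  have hlow := hI c
  rw [hc1 fun s => f.comp ⟨fun x : X => s • x, hc s⟩, hc2] at hlow
  have hcard : ∑ i : Fin T × Bool, ‖(if i.2 then -1 else 1 : ℂ)‖ = 2 * T := by
    rw [Fintype.sum_prod_type]
    simp
    ring
  rw [hcard] at hlow
  have hup : ‖∑ i : Fin T × Bool, (if i.2 then -1 else 1 : ℂ) •
      f.comp ⟨fun x : X => (w ∘ v) i • x, hc _⟩‖ ≤
      T * lam⁻¹ + (t.card * m : ℕ) * (2 * ‖f‖) := by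
    refine (ContinuousMap.norm_le _ (by positivity)).2 fun x => ?_
    let D : Fin T → ℂ := fun i => f (w (v (i, false)) • x) - f (w (v (i, true)) • x)
    have hx : (∑ i : Fin T × Bool, (if i.2 then -1 else 1 : ℂ) •
        f.comp ⟨fun x : X => (w ∘ v) i • x, hc _⟩) x = ∑ i, D i := by
      rw [Fintype.sum_prod_type]
      simp [D, ContinuousMap.sum_apply, sub_eq_neg_add]
    rw [hx]
    let B : Finset (Fin T) := Finset.univ.filter fun i => lam⁻¹ ≤ ‖D i‖
    have hB : B.card ≤ t.card * m := by
      by_contra! hB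
      have hz : ∀ i : Fin T, ∃ z, i ∈ B →
          z ∈ t ∧ w (v (i, false)) • x ∈ U z ∧ w (v (i, true)) • x ∈ V z := fun i => by
        by_cases hi : i ∈ B
        · obtain ⟨z, hz⟩ := hcov _ _ (Finset.mem_filter.1 hi).2
          exact ⟨z, fun _ => hz⟩
        · exact ⟨(x, x), fun h => absurd h hi⟩
      choose ζ hζ using hz
      classical
      obtain ⟨z, hzt, hz⟩ := Finset.exists_lt_card_fiber_of_mul_lt_card_of_maps_to
        (fun i hi => (hζ i hi).1) hB
      obtain ⟨p, hp, hpx⟩ := exists_strictMono_alternating (U z) (V z) (fun i => w i • x)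
        (B.filter fun i => ζ i = z) hz.le
        (fun i hi => by
          obtain ⟨hiB, rfl⟩ := Finset.mem_filter.1 hi
          exact (hζ i hiB).2.1)
        (fun i hi => by
          obtain ⟨hiB, rfl⟩ := Finset.mem_filter.1 hi
          exact (hζ i hiB).2.2)
      exact hnot ⟨z, hzt⟩ p hp ⟨x, hpx⟩
    have hD : ∀ i, ‖D i‖ ≤ lam⁻¹ + if i ∈ B then 2 * ‖f‖ else 0 := fun i => by
      split_ifs with hi
      · have h1 := f.norm_coe_le_norm (w (v (i, false)) • x)
        have h2 := f.norm_coe_le_norm (w (v (i, true)) • x)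
        have h3 := norm_sub_le (f (w (v (i, false)) • x)) (f (w (v (i, true)) • x))
        simp only [D]
        linarith
      · have : ¬ lam⁻¹ ≤ ‖D i‖ := fun h => hi (Finset.mem_filter.2 ⟨Finset.mem_univ _, h⟩)
        linarith
    calc ‖∑ i, D i‖ ≤ ∑ i, (lam⁻¹ + if i ∈ B then 2 * ‖f‖ else 0) :=
          norm_sum_le_of_le _ fun i _ => hD i
      _ = T * lam⁻¹ + B.card * (2 * ‖f‖) := by
          rw [Finset.sum_add_distrib, Finset.sum_ite_mem]
          simp
      _ ≤ _ := by gcongr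
  have hle := hlow.trans hup
  have : (T : ℝ) * lam⁻¹ ≤ (t.card * m : ℕ) * (2 * ‖f‖) := by linarith
  rw [← div_eq_mul_inv, div_le_iff₀ (by positivity)] at this
  linarith

theorem l1_lower_bound_of_isIndepSetG {G : Type*} [Monoid G] {X : Type*}
    [TopologicalSpace X] [CompactSpace X] [MulAction G X]
    (hc : ∀ s : G, Continuous fun x : X => s • x) (f : C(X, ℂ)) {a b : ℂ} {U V : Set X}
    (hU : ∀ z ∈ U, ‖f z - a‖ ≤ ‖a - b‖ / 8) (hV : ∀ z ∈ V, ‖f z - b‖ ≤ ‖a - b‖ / 8)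
    {I : Finset G} (hI : IsIndepSetG ![U, V] (↑I : Set G)) (c : G → ℂ) :
    ‖a - b‖ / 8 * ∑ s ∈ I, ‖c s‖ ≤
      ‖∑ s ∈ I, c s • f.comp ⟨fun x : X => s • x, hc s⟩‖ := by
  rcases I.eq_empty_or_nonempty with rfl | hne
  · simp
  set g : C(X, ℂ) := ∑ s ∈ I, c s • f.comp ⟨fun x : X => s • x, hc s⟩ with hg
  have hgx : ∀ x, g x = ∑ s ∈ I, c s * f (s • x) := fun x => by
    simp [hg, ContinuousMap.sum_apply]
  set S := ∑ s ∈ I, ‖c s‖ with hS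
  obtain ⟨u, hu, hre⟩ : ∃ u : ℂ, ‖u‖ = 1 ∧
      ‖a - b‖ * (S / 2) ≤ ∑ s ∈ I, |(u * (c s * (a - b))).re| := by
    have hsum : ‖a - b‖ * S ≤
        ∑ s ∈ I, |(c s * (a - b)).re| + ∑ s ∈ I, |(c s * (a - b)).im| := by
      rw [hS, Finset.mul_sum, ← Finset.sum_add_distrib]
      refine Finset.sum_le_sum fun s _ => ?_
      rw [mul_comm, ← norm_mul]
      exact Complex.norm_le_abs_re_add_abs_im _
    by_cases h1 : ‖a - b‖ * (S / 2) ≤ ∑ s ∈ I, |(c s * (a - b)).re|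
    · exact ⟨1, by simp, by simpa only [one_mul] using h1⟩
    · refine ⟨-Complex.I, by simp, ?_⟩
      have : ∀ z : ℂ, (-Complex.I * z).re = z.im := fun z => by simp
      simp only [this]
      linarith
  classical
  let e : G → ℂ := fun s => if 0 ≤ (u * (c s * (a - b))).re then 1 else -1
  let σ : G → Fin 2 := fun s => if 0 ≤ (u * (c s * (a - b))).re then 0 else 1
  let τ : G → Fin 2 := fun s => if 0 ≤ (u * (c s * (a - b))).re then 1 else 0
  obtain ⟨p, hp⟩ := hI I hne subset_rfl σ
  obtain ⟨q, hq⟩ := hI I hne subset_rfl τ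
  rw [Set.mem_iInter₂] at hp hq
  have hterm : ∀ s ∈ I, |(u * (c s * (a - b))).re| - ‖a - b‖ / 4 * ‖c s‖ ≤
      (u * (c s * f (s • p) - c s * f (s • q))).re := by
    intro s hs
    have hp' := hp s hs
    have hq' := hq s hs
    have hdiff : ∃ r : ℂ, ‖r‖ ≤ ‖a - b‖ / 4 ∧
        |(u * (c s * (a - b))).re| + (u * (c s * r)).re =
          (u * (c s * f (s • p) - c s * f (s • q))).re := by
      by_cases h0 : 0 ≤ (u * (c s * (a - b))).re
      · simp only [σ, τ, h0, if_true, Set.mem_preimage] at hp' hq'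
        have h1 := hU _ hp'
        have h2 := hV _ hq'
        refine ⟨(f (s • p) - a) - (f (s • q) - b), ?_, ?_⟩
        · have := norm_sub_le (f (s • p) - a) (f (s • q) - b)
          linarith
        · rw [abs_of_nonneg h0, ← Complex.add_re]
          ring_nf
      · simp only [σ, τ, h0, if_false, Set.mem_preimage] at hp' hq'
        have h1 := hV _ hp'
        have h2 := hU _ hq'
        refine ⟨(f (s • p) - b) - (f (s • q) - a), ?_, ?_⟩
        · have := norm_sub_le (f (s • p) - b) (f (s • q) - a)
          linarith
        · rw [abs_of_neg (not_le.1 h0), ← Complex.neg_re, ← Complex.add_re]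
          ring_nf
    obtain ⟨r, hr, heq⟩ := hdiff
    have h3 := (abs_le.1 (Complex.abs_re_le_norm (u * (c s * r)))).1
    have h4 : ‖u * (c s * r)‖ ≤ ‖a - b‖ / 4 * ‖c s‖ := by
      rw [norm_mul, norm_mul, hu, one_mul, mul_comm]
      gcongr
    linarith
  have hsum := Finset.sum_le_sum hterm
  rw [Finset.sum_sub_distrib, ← Finset.mul_sum, ← hS, ← Complex.re_sum, ← Finset.mul_sum,
    Finset.sum_sub_distrib, ← hgx, ← hgx] at hsum
  have h5 := Complex.re_le_norm (u * (g p - g q))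
  rw [norm_mul, hu, one_mul] at h5
  have h6 := norm_sub_le (g p) (g q)
  have h7 := g.norm_coe_le_norm p
  have h8 := g.norm_coe_le_norm q
  linarith

theorem norm_sum_smul_comp_le {G : Type*} [Monoid G] {X : Type*}
    [TopologicalSpace X] [CompactSpace X] [MulAction G X]
    (hc : ∀ s : G, Continuous fun x : X => s • x) (f : C(X, ℂ)) (I : Finset G) (c : G → ℂ) :
    ‖∑ s ∈ I, c s • f.comp ⟨fun x : X => s • x, hc s⟩‖ ≤ ‖f‖ * ∑ s ∈ I, ‖c s‖ := by
  rw [Finset.mul_sum]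
  refine norm_sum_le_of_le _ fun s _ => ?_
  rw [norm_smul, mul_comm]
  gcongr
  exact (ContinuousMap.norm_le _ (norm_nonneg f)).2 fun x => f.norm_coe_le_norm _

/-- Proposition `P-f to pair N`: `f` is nonnull (it has arbitrarily large
finite ℓ1-λ-isomorphism sets for some λ ≥ 1) iff there is an IN-pair `(x, y)` with
`f x ≠ f y`.  Here `s f = f ∘ (s • ·)`. -/
theorem stmt15 {G : Type*} [Monoid G] {X : Type*} [TopologicalSpace X] [CompactSpace X]
    [T2Space X] [MulAction G X]
    (hc : ∀ s : G, Continuous fun x : X => s • x)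
    (hsurj : ∀ s : G, Function.Surjective fun x : X => s • x)
    (f : C(X, ℂ)) :
    (∃ lam : ℝ, 1 ≤ lam ∧ ∀ n : ℕ, ∃ I : Finset G, n ≤ I.card ∧
        ∀ c : G → ℂ,
          lam⁻¹ * ∑ s ∈ I, ‖c s‖ ≤
              ‖∑ s ∈ I, c s • f.comp ⟨fun x : X => s • x, hc s⟩‖ ∧
            ‖∑ s ∈ I, c s • f.comp ⟨fun x : X => s • x, hc s⟩‖ ≤
              lam * ∑ s ∈ I, ‖c s‖) ↔
      ∃ x y : X, IsINTuple G ![x, y] ∧ f x ≠ f y := by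
  constructor
  · rintro ⟨lam, hlam, h⟩
    refine exists_isINTuple_of_l1_isomorphism hc f hlam fun n => ?_
    obtain ⟨I, hn, hI⟩ := h n
    exact ⟨I, hn, fun c => (hI c).1⟩
  · rintro ⟨x, y, hxy, hne⟩
    have hd : 0 < ‖f x - f y‖ := norm_pos_iff.2 (sub_ne_zero.2 hne)
    refine ⟨max 1 (max (8 / ‖f x - f y‖) ‖f‖), le_max_left _ _, fun n => ?_⟩
    have hopen : ∀ a : ℂ, IsOpen {z : X | ‖f z - a‖ < ‖f x - f y‖ / 8} := fun a =>
      isOpen_lt (by fun_prop) continuous_const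
    obtain ⟨I, hn, hI⟩ := hxy
      ![{z | ‖f z - f x‖ < ‖f x - f y‖ / 8}, {z | ‖f z - f y‖ < ‖f x - f y‖ / 8}]
      (Fin.forall_fin_two.2 ⟨hopen _, hopen _⟩)
      (Fin.forall_fin_two.2 ⟨by simpa using hd, by simpa using hd⟩) n
    refine ⟨I, hn, fun c => ⟨?_, ?_⟩⟩
    · refine le_trans ?_ (l1_lower_bound_of_isIndepSetG hc f (fun z hz => le_of_lt hz)
        (fun z hz => le_of_lt hz) hI c)
      gcongr
      rw [inv_le_comm₀ (by positivity) (by positivity), inv_div]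
      exact (le_max_left _ _).trans (le_max_right _ _)
    · refine (norm_sum_smul_comp_le hc f I c).trans ?_
      gcongr
      exact (le_max_right _ _).trans (le_max_right _ _)
end

section
/- Let (X, G) be a dynamical system and let f ∈ C(X). Then f has an infinite ℓ1-isomorphism set if and only if there exists an IT-pair (x, y) with f(x) ≠ f(y). -/
open Filter Set

section Convexity

open MeasureTheory Topology CompactlySupported

variable {X : Type*} [TopologicalSpace X] [CompactSpace X] [T2Space X]

/-- A continuous functional on `C(X, ℝ)` that is nonnegative on nonnegative functions is
integration against a finite Borel measure. -/
lemma exists_measure_of_nonneg_dual [MeasurableSpace X] [BorelSpace X]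
    (φ : StrongDual ℝ C(X, ℝ)) (hφ : ∀ h : C(X, ℝ), (∀ x, 0 ≤ h x) → 0 ≤ φ h) :
    ∃ μ : Measure X, IsFiniteMeasure μ ∧ ∀ h : C(X, ℝ), ∫ x, h x ∂μ = φ h := by
  let L : C_c(X, ℝ) →ₗ[ℝ] ℝ :=
    { toFun := fun h => φ h.toContinuousMap
      map_add' := fun a b => φ.map_add a.toContinuousMap b.toContinuousMap
      map_smul' := fun c a => φ.map_smul c a.toContinuousMap }
  let Λ : C_c(X, ℝ) →ₚ[ℝ] ℝ := PositiveLinearMap.mk₀ L fun h hh => hφ _ hh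
  refine ⟨RealRMK.rieszMeasure Λ, ⟨?_⟩, fun h => ?_⟩
  · exact isCompact_univ.measure_lt_top
  · exact RealRMK.integral_rieszMeasure Λ
      (CompactlySupportedContinuousMap.continuousMapEquiv h)

/-- A uniformly bounded sequence of continuous functions on a compact space which is eventually
at most `δ` at every point has a convex combination smaller than any given `ε > δ`. -/
lemma exists_convex_combination_lt (g : ℕ → C(X, ℝ)) {B δ ε : ℝ}
    (hB : ∀ n x, |g n x| ≤ B) (hδ : ∀ x, ∀ᶠ n in atTop, g n x ≤ δ) (h0 : 0 ≤ δ) (hε : δ < ε) :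
    ∃ a : ℕ →₀ ℝ, (∀ n, 0 ≤ a n) ∧ ∑ n ∈ a.support, a n = 1 ∧
      ∀ x, ∑ n ∈ a.support, a n * g n x < ε := by
  by_contra! hcon
  let s : Set C(X, ℝ) := {h | ∀ x, h x < ε}
  let S : Set (ℕ →₀ ℝ) :=
    {a | (∀ n, 0 ≤ a n) ∧ Finsupp.linearCombination ℝ (fun _ : ℕ => (1 : ℝ)) a = 1}
  let t : Set C(X, ℝ) := Finsupp.linearCombination ℝ g '' S
  have hs_open : IsOpen s := by
    simpa [MapsTo] using
      ContinuousMap.isOpen_setOfPred_mapsTo (X := X) isCompact_univ (isOpen_Iio (a := ε))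
  have hs : Convex ℝ s := by
    intro h hh k hk p q hp hq hpq x
    exact (convex_Iio ε) (hh x) (hk x) hp hq hpq
  have hS : Convex ℝ S := by
    intro a ha b hb p q hp hq hpq
    refine ⟨fun n => ?_, ?_⟩
    · have := mul_nonneg hp (ha.1 n)
      have := mul_nonneg hq (hb.1 n)
      simp only [Finsupp.add_apply, Finsupp.smul_apply, smul_eq_mul]
      positivity
    · rw [map_add, map_smul, map_smul, ha.2, hb.2]
      simpa using hpq
  have ht : Convex ℝ t := hS.linear_image _
  have hdisj : Disjoint s t := by
    rw [Set.disjoint_left]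
    rintro _ hh ⟨a, ⟨ha, ha1⟩, rfl⟩
    obtain ⟨x, hx⟩ := hcon a ha (by
      simpa [Finsupp.linearCombination_apply, Finsupp.sum] using ha1)
    have := hh x
    rw [Finsupp.linearCombination_apply, Finsupp.sum, ContinuousMap.sum_apply] at this
    simp only [ContinuousMap.smul_apply, smul_eq_mul] at this
    exact absurd this (not_lt.2 hx)
  obtain ⟨φ, u, hφs, hφt⟩ := geometric_hahn_banach_open hs hs_open ht hdisj
  have hpos : ∀ h : C(X, ℝ), (∀ x, 0 ≤ h x) → 0 ≤ φ h := by
    intro h hh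
    by_contra! hneg
    obtain ⟨n, hn⟩ := exists_nat_gt (u / (-φ h))
    have hmem : (-(n : ℝ)) • h ∈ s := fun x => by
      have := mul_nonneg n.cast_nonneg (hh x) (α := ℝ)
      simp only [ContinuousMap.smul_apply, smul_eq_mul]
      linarith
    have h1 := hφs _ hmem
    rw [map_smul, smul_eq_mul] at h1
    rw [div_lt_iff₀ (by linarith)] at hn
    linarith
  have hgn : ∀ n, u ≤ φ (g n) := fun n => by
    refine hφt _ ⟨Finsupp.single n 1, ⟨fun m => ?_, by simp⟩, by simp⟩
    rw [Finsupp.single_apply]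
    split_ifs <;> norm_num
  let _ : MeasurableSpace X := borel X
  have : BorelSpace X := ⟨rfl⟩
  obtain ⟨μ, hμ, hint⟩ := exists_measure_of_nonneg_dual φ hpos
  have hlim : Tendsto (fun n => ∫ x, max (g n x) δ ∂μ) atTop (𝓝 (∫ _, δ ∂μ)) := by
    refine tendsto_integral_of_dominated_convergence (fun _ => max B δ)
      (fun n => ((g n).continuous.max continuous_const).aestronglyMeasurable)
      (integrable_const _) (fun n => Eventually.of_forall fun x => ?_)
      (Eventually.of_forall fun x => ?_)
    · rw [Real.norm_of_nonneg (le_max_of_le_right h0)]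
      exact max_le_max_right _ ((le_abs_self _).trans (hB n x))
    · refine tendsto_const_nhds.congr' ?_
      filter_upwards [hδ x] with n hn
      rw [max_eq_right hn]
  have hle : u ≤ ∫ _, δ ∂μ := by
    refine ge_of_tendsto' hlim fun n => (hgn n).trans ?_
    rw [← hint]
    have hmax : Continuous fun x => max (g n x) δ := (g n).continuous.max continuous_const
    exact integral_mono
      ((g n).continuous.integrable_of_hasCompactSupport (HasCompactSupport.of_compactSpace _))
      (hmax.integrable_of_hasCompactSupport (HasCompactSupport.of_compactSpace _))
      fun x => le_max_left _ _
  have hlt : φ (ContinuousMap.const X δ) < u := hφs _ fun x => hε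
  rw [← hint] at hlt
  simp only [ContinuousMap.const_apply] at hlt
  exact absurd hle (not_le.2 hlt)

end Convexity

section Dichotomy

/-- Diagonalization: if a property of states persists, for almost all `n` along a filter finer
than the cofinite one, under each of finitely many transitions `R i n`, then a strictly increasing
sequence of indices can be chosen along which finite collections of good states are closed under
the transitions. -/
lemma exists_strictMono_transitions {T ι : Type*} [Finite ι] {l : Filter ℕ} [l.NeBot]
    (hl : l ≤ cofinite) (R : ι → ℕ → T → T) (P : T → Prop)
    (hP : ∀ t, P t → ∀ i, ∀ᶠ n in l, P (R i n t)) (Q₀ : Set T) (hQ₀ : Q₀.Finite)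
    (hPQ₀ : ∀ t ∈ Q₀, P t) :
    ∃ (n : ℕ → ℕ) (Q : ℕ → Set T), StrictMono n ∧ Q 0 = Q₀ ∧ (∀ k, ∀ t ∈ Q k, P t) ∧
      Monotone Q ∧ ∀ k, ∀ t ∈ Q k, ∀ i, R i (n k) t ∈ Q (k + 1) := by
  have next : ∀ (m : ℕ) (Q : {Q : Set T // Q.Finite ∧ ∀ t ∈ Q, P t}),
      ∃ n, m < n ∧ ∀ t ∈ Q.1, ∀ i, P (R i n t) := by
    intro m Q
    have h1 : ∀ᶠ n in l, m < n := by
      have : ∀ᶠ n in cofinite, m < n := by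
        rw [Nat.cofinite_eq_atTop]; exact eventually_gt_atTop m
      exact hl this
    have h2 : ∀ᶠ n in l, ∀ t ∈ Q.1, ∀ i, P (R i n t) := by
      rw [eventually_all_finite Q.2.1]
      intro t ht
      rw [eventually_all]
      exact hP t (Q.2.2 t ht)
    exact (h1.and h2).exists
  choose N hN hNP using next
  let F : ℕ × {Q : Set T // Q.Finite ∧ ∀ t ∈ Q, P t} →
      ℕ × {Q : Set T // Q.Finite ∧ ∀ t ∈ Q, P t} := fun p =>
    ⟨N p.1 p.2, ⟨p.2.1 ∪ ⋃ i, R i (N p.1 p.2) '' p.2.1,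
      p.2.2.1.union (finite_iUnion fun i => p.2.2.1.image _), by
        rintro t (ht | ht)
        · exact p.2.2.2 t ht
        · obtain ⟨i, s, hs, rfl⟩ := mem_iUnion.1 ht
          exact hNP _ _ s hs i⟩⟩
  let q : ℕ → ℕ × {Q : Set T // Q.Finite ∧ ∀ t ∈ Q, P t} := fun k => F^[k] (0, ⟨Q₀, hQ₀, hPQ₀⟩)
  have hq : ∀ k, q (k + 1) = F (q k) := fun k => Function.iterate_succ_apply' F k _
  refine ⟨fun k => (q (k + 1)).1, fun k => (q k).2.1, strictMono_nat_of_lt_succ fun k => ?_, rfl,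
    fun k => (q k).2.2.2, monotone_nat_of_le_succ fun k => ?_, fun k t ht i => ?_⟩
  · rw [hq (k + 1)]
    exact hN _ _
  · simp only [hq k]
    exact subset_union_left
  · simp only [hq k]
    exact Or.inr (mem_iUnion.2 ⟨i, t, ht, rfl⟩)

/-- Well-founded trees branching over `ℕ`, each node of which carries a label. -/
inductive LabeledTree (ι : Type) : Type
  | leaf : LabeledTree ι
  | node (i : ι) (child : ℕ → LabeledTree ι) : LabeledTree ι

instance (ι : Type) : Nonempty (LabeledTree ι) := ⟨.leaf⟩

/-- The tree `t` witnesses that `S` gets exhausted by successively intersecting with the sets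
`C n i`, where `i` is the label of the current node and `n` may be almost any index along `l`. -/
def LabeledTree.Exhausts {X : Type*} {ι : Type} (l : Filter ℕ) (C : ℕ → ι → Set X) :
    LabeledTree ι → Set X → Prop
  | .leaf, S => S = ∅
  | .node i child, S => ∀ᶠ n in l, (child n).Exhausts l C (S ∩ C n i)

/-- If no tree exhausts the whole space, then there is a subsequence of `C` any finite pattern of
which is realized. -/
lemma exists_strictMono_independent {X : Type*} {ι : Type} [Finite ι] {l : Ultrafilter ℕ}
    (hl : (l : Filter ℕ) ≤ cofinite) (C : ℕ → ι → Set X)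
    (hC : ∀ t : LabeledTree ι, ¬ t.Exhausts l C univ) :
    ∃ n : ℕ → ℕ, StrictMono n ∧ ∀ (σ : ℕ → ι) (k : ℕ),
      (⋂ j < k, C (n j) (σ j)).Nonempty := by
  obtain ⟨n, Q, hn, hQ0, hQP, -, hQR⟩ := exists_strictMono_transitions hl
    (fun i n S => S ∩ C n i) (fun S => ∀ t : LabeledTree ι, ¬ t.Exhausts l C S) (by
      intro S hS i
      simp only [← not_exists]
      rw [Ultrafilter.eventually_not]
      intro h
      obtain ⟨child, hchild⟩ : ∃ child : ℕ → LabeledTree ι, ∀ n,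
          (∃ t : LabeledTree ι, t.Exhausts l C (S ∩ C n i)) →
            (child n).Exhausts l C (S ∩ C n i) := by
        refine ⟨fun n => Classical.epsilon fun t => t.Exhausts l C (S ∩ C n i), fun n hn => ?_⟩
        exact Classical.epsilon_spec hn
      exact hS (.node i child) (h.mono hchild)) {univ} (finite_singleton _) (by simpa using hC)
  refine ⟨n, hn, fun σ k => ?_⟩
  suffices h : ∃ S ∈ Q k, S ⊆ ⋂ j < k, C (n j) (σ j) by
    obtain ⟨S, hSQ, hS⟩ := h
    exact (nonempty_iff_ne_empty.2 (hQP k S hSQ .leaf)).mono hS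
  induction k with
  | zero => exact ⟨univ, by simp [hQ0], by simp⟩
  | succ k ih =>
    obtain ⟨S, hSQ, hS⟩ := ih
    refine ⟨_, hQR k S hSQ (σ k), fun x hx => ?_⟩
    simp only [mem_iInter]
    intro j hj
    rcases Nat.lt_succ_iff_lt_or_eq.1 hj with hj | rfl
    · exact mem_iInter₂.1 (hS hx.1) j hj
    · exact hx.2

/-- If for each of finitely many sequences `C p` some tree exhausts the whole space, then there is
a common subsequence along which every point eventually avoids, for each `p`, the sets
`C p n i` for some `i`. -/
lemma exists_strictMono_eventually_notMem {X P : Type*} {ι : Type} {l : Filter ℕ} [l.NeBot]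
    (hl : l ≤ cofinite) (C : P → ℕ → ι → Set X) (F : Finset P)
    (hC : ∀ p ∈ F, ∃ t : LabeledTree ι, t.Exhausts l (C p) univ) :
    ∃ n : ℕ → ℕ, StrictMono n ∧ ∀ p ∈ F, ∀ x, ∃ i, ∀ᶠ k in atTop, x ∉ C p (n k) i := by
  choose! tree htree using hC
  let R : Unit → ℕ → P × LabeledTree ι × Set X → P × LabeledTree ι × Set X := fun _ n q =>
    match q with
    | (p, .leaf, S) => (p, .leaf, S)
    | (p, .node i child, S) => (p, child n, S ∩ C p n i)
  obtain ⟨n, Q, hn, hQ0, hQP, hQmono, hQR⟩ := exists_strictMono_transitions hl R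
    (fun q => q.2.1.Exhausts l (C q.1) q.2.2) (by
      rintro ⟨p, t, S⟩ h -
      cases t with
      | leaf => exact Eventually.of_forall fun _ => h
      | node i child => exact h)
    ((fun p => (p, tree p, univ)) '' F) (F.finite_toSet.image _) (by
      rintro _ ⟨p, hp, rfl⟩
      exact htree p hp)
  have key : ∀ p (t : LabeledTree ι) (S : Set X) (k : ℕ), (p, t, S) ∈ Q k → ∀ x ∈ S,
      ∃ i, ∀ᶠ j in atTop, x ∉ C p (n j) i := by
    intro p t
    induction t with
    | leaf =>
      intro S k hk x hx
      have : S = ∅ := hQP k _ hk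
      simp [this] at hx
    | node i child ih =>
      intro S k hk x hx
      by_contra! hcon
      have hfreq : ∃ᶠ j in atTop, x ∈ C p (n j) i := by
        intro h
        exact hcon i h
      obtain ⟨j, hj, hxj⟩ := frequently_atTop.1 hfreq k
      obtain ⟨i', hi'⟩ := ih (n j) _ (j + 1) (hQR j _ (hQmono hj hk) ()) x ⟨hx, hxj⟩
      exact hcon i' hi'
  refine ⟨n, hn, fun p hp x => key p (tree p) univ 0 ?_ x (mem_univ x)⟩
  rw [hQ0]
  exact ⟨p, hp, rfl⟩

end Dichotomy

section Independence

open Topology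

variable {G : Type*} [Monoid G] {X : Type*} [MulAction G X]

/-- A sequence of pairwise distinct elements of `G` all of whose finite patterns are realized
has an independence set as its range. -/
lemma isIndepSetG_range {k : ℕ} {A : Fin k → Set X} {s : ℕ → G} (hs : Function.Injective s)
    (h : ∀ (σ : ℕ → Fin k) (m : ℕ),
      (⋂ j < m, (fun x : X => s j • x) ⁻¹' A (σ j)).Nonempty) :
    IsIndepSetG A (range s) := by
  intro I _ hI σ
  have hfin : (s ⁻¹' (I : Set G)).Finite := I.finite_toSet.preimage hs.injOn
  obtain ⟨m, hm⟩ := hfin.bddAbove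
  refine (h (fun j => σ (s j)) (m + 1)).mono fun x hx => ?_
  simp only [mem_iInter] at hx ⊢
  intro g hg
  obtain ⟨j, rfl⟩ := hI hg
  exact hx j (Nat.lt_succ_of_le (hm hg))

/-- If no pair of points separated by `f` is an IT-pair, then along any sequence of distinct
elements of `G` there is a subsequence on which `f` eventually varies by less than `δ` along every
orbit. -/
lemma exists_strictMono_orbit_oscillation_lt [TopologicalSpace X] [CompactSpace X]
    {f : C(X, ℂ)} (hf : ∀ x y : X, IsITTuple G ![x, y] → f x = f y) {s : ℕ → G}
    (hs : Function.Injective s) {δ : ℝ} (hδ : 0 < δ) :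
    ∃ n : ℕ → ℕ, StrictMono n ∧ ∀ (u v : ℕ → ℕ), Tendsto u atTop atTop → Tendsto v atTop atTop →
      ∀ x : X, ∀ᶠ k in atTop, ‖f (s (n (u k)) • x) - f (s (n (v k)) • x)‖ < δ := by
  let K : Set (X × X) := {z | δ ≤ ‖f z.1 - f z.2‖}
  have hK : IsCompact K := by
    refine IsClosed.isCompact (isClosed_le continuous_const ?_)
    fun_prop
  have hW : ∀ z ∈ K, ∃ W : Fin 2 → Set X, (∀ i, IsOpen (W i)) ∧ z.1 ∈ W 0 ∧ z.2 ∈ W 1 ∧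
      ∀ J : Set G, J.Infinite → ¬ IsIndepSetG W J := by
    intro z hz
    have hne : f z.1 ≠ f z.2 := by
      intro h
      have : δ ≤ ‖f z.1 - f z.2‖ := hz
      rw [h, sub_self, norm_zero] at this
      linarith
    have hnot := mt (hf z.1 z.2) hne
    unfold IsITTuple at hnot
    push Not at hnot
    obtain ⟨W, hWo, hWz, hWJ⟩ := hnot
    exact ⟨W, hWo, by simpa using hWz 0, by simpa using hWz 1, hWJ⟩
  choose! W hWo hW0 hW1 hWJ using hW
  obtain ⟨F, hFK, hF⟩ := hK.elim_nhds_subcover (fun z => W z 0 ×ˢ W z 1) fun z hz =>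
    prod_mem_nhds ((hWo z hz 0).mem_nhds (hW0 z hz)) ((hWo z hz 1).mem_nhds (hW1 z hz))
  let C : X × X → ℕ → Fin 2 → Set X := fun z n i => (fun x : X => s n • x) ⁻¹' W z i
  have hl : ((hyperfilter ℕ : Ultrafilter ℕ) : Filter ℕ) ≤ cofinite := hyperfilter_le_cofinite
  obtain ⟨n, hn, hnF⟩ := exists_strictMono_eventually_notMem hl C F (by
    intro z hz
    by_contra! hcon
    obtain ⟨n, hn, hind⟩ := exists_strictMono_independent hl (C z) hcon
    have hinj : Function.Injective fun k => s (n k) := hs.comp hn.injective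
    exact hWJ z (hFK z hz) _ (infinite_range_of_injective hinj) (isIndepSetG_range hinj hind))
  refine ⟨n, hn, fun u v hu hv x => ?_⟩
  have hall : ∀ᶠ k in atTop, ∀ z ∈ F,
      ¬ (s (n (u k)) • x ∈ W z 0 ∧ s (n (v k)) • x ∈ W z 1) := by
    rw [Finset.eventually_all]
    intro z hz
    obtain ⟨i, hi⟩ := hnF z hz x
    fin_cases i
    · exact (hu.eventually hi).mono fun k hk h => hk h.1
    · exact (hv.eventually hi).mono fun k hk h => hk h.2
  filter_upwards [hall] with k hk
  by_contra! hcon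
  have hmem : (s (n (u k)) • x, s (n (v k)) • x) ∈ K := hcon
  obtain ⟨z, hz, hmem⟩ := mem_iUnion₂.1 (hF hmem)
  exact hk z hz hmem

end Independence

section LOne

variable {G : Type*} [Monoid G] {X : Type*} [TopologicalSpace X] [CompactSpace X]
  [MulAction G X]

/-- The values of `f` at two points of an independent pair of neighbourhoods force a lower
`ℓ¹`-estimate for the real parts. -/
lemma IsIndepSetG.sum_abs_re_le {f : C(X, ℂ)} (hc : ∀ s : G, Continuous fun x : X => s • x)
    {W : Fin 2 → Set X} {J : Set G} (hJ : IsIndepSetG W J) {a b : ℂ} {ε : ℝ}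
    (h0 : ∀ x ∈ W 0, ‖f x - a‖ ≤ ε) (h1 : ∀ x ∈ W 1, ‖f x - b‖ ≤ ε)
    {I : Finset G} (hI : ↑I ⊆ J) (c : G → ℂ) :
    ∑ s ∈ I, |(c s * (a - b)).re| - 2 * ε * ∑ s ∈ I, ‖c s‖ ≤
      2 * ‖∑ s ∈ I, c s • f.comp ⟨fun x : X => s • x, hc s⟩‖ := by
  rcases I.eq_empty_or_nonempty with rfl | hne
  · simp
  set h := ∑ s ∈ I, c s • f.comp ⟨fun x : X => s • x, hc s⟩ with hh
  have happ : ∀ x, h x = ∑ s ∈ I, c s * f (s • x) := fun x => by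
    rw [hh, ContinuousMap.sum_apply]; rfl
  obtain ⟨p, hp⟩ := hJ I hne hI fun s => if 0 ≤ (c s * (a - b)).re then 0 else 1
  obtain ⟨q, hq⟩ := hJ I hne hI fun s => if 0 ≤ (c s * (a - b)).re then 1 else 0
  simp only [mem_iInter, mem_preimage] at hp hq
  have hterm : ∀ s ∈ I, |(c s * (a - b)).re| - 2 * ε * ‖c s‖ ≤
      (c s * f (s • p) - c s * f (s • q)).re := by
    intro s hs
    have hps := hp s hs
    have hqs := hq s hs
    have aux : ∀ y z : ℂ, ‖y‖ ≤ ε → ‖z‖ ≤ ε → -(2 * ε * ‖c s‖) ≤ (c s * (y - z)).re := by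
      intro y z hy hz
      have h2 : ‖c s * (y - z)‖ ≤ ‖c s‖ * (2 * ε) := by
        rw [norm_mul]
        refine mul_le_mul_of_nonneg_left ?_ (norm_nonneg _)
        linarith [norm_sub_le y z]
      have h3 := (abs_le.1 (Complex.abs_re_le_norm (c s * (y - z)))).1
      linarith
    split_ifs at hps hqs with hsign
    · have h4 := aux _ _ (h0 _ hps) (h1 _ hqs)
      have h5 : c s * f (s • p) - c s * f (s • q) =
          c s * (a - b) + c s * ((f (s • p) - a) - (f (s • q) - b)) := by ring
      rw [h5, Complex.add_re, abs_of_nonneg hsign]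
      linarith
    · have h4 := aux _ _ (h1 _ hps) (h0 _ hqs)
      have h5 : c s * f (s • p) - c s * f (s • q) =
          -(c s * (a - b)) + c s * ((f (s • p) - b) - (f (s • q) - a)) := by ring
      rw [h5, Complex.add_re, Complex.neg_re, abs_of_neg (not_le.1 hsign)]
      linarith
  calc ∑ s ∈ I, |(c s * (a - b)).re| - 2 * ε * ∑ s ∈ I, ‖c s‖
      = ∑ s ∈ I, (|(c s * (a - b)).re| - 2 * ε * ‖c s‖) := by
        rw [Finset.sum_sub_distrib, Finset.mul_sum]
    _ ≤ ∑ s ∈ I, (c s * f (s • p) - c s * f (s • q)).re := Finset.sum_le_sum hterm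
    _ = (h p - h q).re := by
        rw [happ, happ, ← Finset.sum_sub_distrib, Complex.re_sum]
    _ ≤ ‖h p - h q‖ := Complex.re_le_norm _
    _ ≤ ‖h p‖ + ‖h q‖ := norm_sub_le _ _
    _ ≤ 2 * ‖h‖ := by linarith [h.norm_coe_le_norm p, h.norm_coe_le_norm q]

/-- An independent pair of sets on which `f` takes well-separated values yields a lower
`ℓ¹`-estimate. -/
lemma IsIndepSetG.sum_norm_le {f : C(X, ℂ)} (hc : ∀ s : G, Continuous fun x : X => s • x)
    {W : Fin 2 → Set X} {J : Set G} (hJ : IsIndepSetG W J) {a b : ℂ}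
    (h0 : ∀ x ∈ W 0, ‖f x - a‖ ≤ ‖a - b‖ / 8) (h1 : ∀ x ∈ W 1, ‖f x - b‖ ≤ ‖a - b‖ / 8)
    {I : Finset G} (hI : ↑I ⊆ J) (c : G → ℂ) :
    ‖a - b‖ / 8 * ∑ s ∈ I, ‖c s‖ ≤
      ‖∑ s ∈ I, c s • f.comp ⟨fun x : X => s • x, hc s⟩‖ := by
  have hre := hJ.sum_abs_re_le hc h0 h1 hI c
  have him := hJ.sum_abs_re_le hc h0 h1 hI fun s => Complex.I * c s
  have hnorm : ‖∑ s ∈ I, (Complex.I * c s) • f.comp ⟨fun x : X => s • x, hc s⟩‖ =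
      ‖∑ s ∈ I, c s • f.comp ⟨fun x : X => s • x, hc s⟩‖ := by
    simp only [mul_smul, ← Finset.smul_sum]
    rw [norm_smul, Complex.norm_I, one_mul]
  rw [hnorm] at him
  simp only [norm_mul, Complex.norm_I, one_mul, mul_assoc, Complex.I_mul_re, abs_neg] at him
  have hsum : ‖a - b‖ * ∑ s ∈ I, ‖c s‖ ≤
      ∑ s ∈ I, |(c s * (a - b)).re| + ∑ s ∈ I, |(c s * (a - b)).im| := by
    rw [Finset.mul_sum, ← Finset.sum_add_distrib]
    refine Finset.sum_le_sum fun s _ => ?_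
    rw [mul_comm, ← norm_mul]
    exact Complex.norm_le_abs_re_add_abs_im _
  linarith

/-- An `ℓ¹`-lower bound over an infinite set of translates of `f` yields an IT-pair separated
by `f`. -/
lemma exists_isITTuple_of_sum_norm_le [T2Space X] {f : C(X, ℂ)}
    (hc : ∀ s : G, Continuous fun x : X => s • x) {ε : ℝ} (hε : 0 < ε) {J : Set G}
    (hJ : J.Infinite)
    (h : ∀ I : Finset G, ↑I ⊆ J → ∀ c : G → ℂ,
      ε * ∑ s ∈ I, ‖c s‖ ≤ ‖∑ s ∈ I, c s • f.comp ⟨fun x : X => s • x, hc s⟩‖) :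
    ∃ x y : X, IsITTuple G ![x, y] ∧ f x ≠ f y := by
  by_contra! hcon
  let s : ℕ → G := fun n => hJ.natEmbedding J n
  have hs : Function.Injective s := Subtype.val_injective.comp (hJ.natEmbedding J).injective
  obtain ⟨n, hn, hosc⟩ := exists_strictMono_orbit_oscillation_lt hcon hs hε
  let e : ℕ × Bool → G := fun p => s (n (2 * p.1 + p.2.toNat))
  have he : Function.Injective e := by
    rintro ⟨m, b⟩ ⟨m', b'⟩ hmm
    have := hn.injective (hs hmm)
    cases b <;> cases b' <;> simp at this ⊢ <;> omega
  have heJ : ∀ p, e p ∈ J := fun p => (hJ.natEmbedding J _).2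
  let T : G → C(X, ℂ) := fun s => f.comp ⟨fun x : X => s • x, hc s⟩
  let g : ℕ → C(X, ℝ) := fun m => ⟨fun x => ‖T (e (m, false)) x - T (e (m, true)) x‖, by fun_prop⟩
  have hg : ∀ x, ∀ᶠ m in atTop, g m x ≤ ε := fun x => by
    have h2 : Tendsto (fun m : ℕ => 2 * m) atTop atTop :=
      tendsto_id.const_mul_atTop' two_pos
    exact (hosc (fun m => 2 * m) (fun m => 2 * m + 1) h2
      ((tendsto_add_atTop_nat 1).comp h2) x).mono fun m hm => hm.le
  have hB : ∀ m x, |g m x| ≤ ‖f‖ + ‖f‖ := fun m x => by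
    have hgm : g m x = ‖T (e (m, false)) x - T (e (m, true)) x‖ := rfl
    rw [hgm, abs_norm]
    refine (norm_sub_le _ _).trans ?_
    exact add_le_add (f.norm_coe_le_norm _) (f.norm_coe_le_norm _)
  obtain ⟨a, ha0, ha1, hlt⟩ :=
    exists_convex_combination_lt g hB hg hε.le (show ε < ε * 2 by linarith)
  let c' : ℕ × Bool → ℂ := fun p => if p.2 then -(a p.1 : ℂ) else a p.1
  let c : G → ℂ := Function.extend e c' 0
  have hce : ∀ p, c (e p) = c' p := fun p => he.extend_apply c' 0 p
  let I : Finset G := (a.support ×ˢ Finset.univ).map ⟨e, he⟩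
  have hI : (I : Set G) ⊆ J := by
    intro g hg
    obtain ⟨p, -, rfl⟩ := Finset.mem_map.1 (Finset.mem_coe.1 hg)
    exact heJ p
  have hsum1 : ∑ s ∈ I, ‖c s‖ = 2 := by
    have hm : ∀ m, |a m| = a m := fun m => abs_of_nonneg (ha0 m)
    simp only [I, Finset.sum_map, Function.Embedding.coeFn_mk, hce, Finset.sum_product, c',
      Fintype.sum_bool, if_true, Bool.false_eq_true, if_false, norm_neg, Complex.norm_real,
      Real.norm_eq_abs, hm, Finset.sum_add_distrib, ha1]
    norm_num
  have hsum2 : ‖∑ s ∈ I, c s • T s‖ < ε * 2 := by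
    rw [ContinuousMap.norm_lt_iff _ (by positivity)]
    intro x
    refine lt_of_le_of_lt ?_ (hlt x)
    simp only [I, Finset.sum_map, Function.Embedding.coeFn_mk, hce, Finset.sum_product, c',
      Fintype.sum_bool, if_true, Bool.false_eq_true, if_false, ContinuousMap.sum_apply,
      ContinuousMap.add_apply, ContinuousMap.smul_apply]
    refine (norm_sum_le _ _).trans (Finset.sum_le_sum fun m _ => le_of_eq ?_)
    rw [smul_eq_mul, smul_eq_mul, neg_mul, neg_add_eq_sub, ← mul_sub, norm_mul,
      Complex.norm_real, Real.norm_of_nonneg (ha0 m)]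
    rfl
  have := h I hI c
  rw [hsum1] at this
  exact absurd hsum2 (not_lt.2 this)

end LOne

/-- Proposition `P-f to pair R`: `f` has an infinite ℓ1-isomorphism set
(an infinite `J ⊆ G` which is an ℓ1-λ-isomorphism set for some λ ≥ 1) iff there is an
IT-pair `(x, y)` with `f x ≠ f y`.  Here `s f = f ∘ (s • ·)`. -/
theorem stmt16 {G : Type*} [Monoid G] {X : Type*} [TopologicalSpace X] [CompactSpace X]
    [T2Space X] [MulAction G X]
    (hc : ∀ s : G, Continuous fun x : X => s • x)
    (hsurj : ∀ s : G, Function.Surjective fun x : X => s • x)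
    (f : C(X, ℂ)) :
    (∃ lam : ℝ, 1 ≤ lam ∧ ∃ J : Set G, J.Infinite ∧
        ∀ I : Finset G, ↑I ⊆ J → ∀ c : G → ℂ,
          lam⁻¹ * ∑ s ∈ I, ‖c s‖ ≤
              ‖∑ s ∈ I, c s • f.comp ⟨fun x : X => s • x, hc s⟩‖ ∧
            ‖∑ s ∈ I, c s • f.comp ⟨fun x : X => s • x, hc s⟩‖ ≤
              lam * ∑ s ∈ I, ‖c s‖) ↔
      ∃ x y : X, IsITTuple G ![x, y] ∧ f x ≠ f y := by
  constructor
  · rintro ⟨lam, hlam, J, hJ, h⟩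
    exact exists_isITTuple_of_sum_norm_le hc (inv_pos.2 (by linarith)) hJ
      fun I hI c => (h I hI c).1
  · rintro ⟨x, y, hxy, hne⟩
    have hd : 0 < ‖f x - f y‖ := norm_pos_iff.2 (sub_ne_zero.2 hne)
    have hopen : ∀ z, IsOpen {p : X | ‖f p - f z‖ < ‖f x - f y‖ / 8} := fun z =>
      isOpen_lt (by fun_prop) continuous_const
    obtain ⟨J, hJ, hind⟩ := hxy
      ![{p | ‖f p - f x‖ < ‖f x - f y‖ / 8}, {p | ‖f p - f y‖ < ‖f x - f y‖ / 8}]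
      (by simp [Fin.forall_fin_two, hopen]) (by simp [Fin.forall_fin_two, hd])
    refine ⟨max 1 (max (8 / ‖f x - f y‖) ‖f‖), le_max_left _ _, J, hJ, fun I hI c => ⟨?_, ?_⟩⟩
    · refine le_trans ?_ (hind.sum_norm_le hc (fun p hp => hp.le) (fun p hp => hp.le) hI c)
      refine mul_le_mul_of_nonneg_right ?_ (Finset.sum_nonneg fun _ _ => norm_nonneg _)
      rw [← inv_div 8 ‖f x - f y‖]
      exact inv_anti₀ (by positivity) ((le_max_left _ _).trans (le_max_right _ _))
    · refine (norm_sum_le _ _).trans ?_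
      rw [Finset.mul_sum]
      refine Finset.sum_le_sum fun s _ => ?_
      rw [norm_smul, mul_comm]
      refine mul_le_mul_of_nonneg_right (le_trans ?_ ((le_max_right _ _).trans (le_max_right _ _)))
        (norm_nonneg _)
      exact (ContinuousMap.norm_le _ (norm_nonneg _)).2 fun p => f.norm_coe_le_norm _
end
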